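/- arXiv:1610.05471 — 9 statements merged into one kernel-verified Lean document; each statement's English description precedes it below -/
import Mathlib

section
/- Fix a signal-to-noise ratio γ > 0 and a communication cost c > 0. For a threshold β ≥ 0 define the cost J(β) = 2∫_0^β x² p(x) dx + (2/(γ+1))·V(β) + 2c·∫_β^∞ p(x) dx, where V(β) = ∫_β^∞ x² p(x) dx − (∫_β^∞ x p(x) dx)²/(∫_β^∞ p(x) dx). For every measurable partition of ℝ into sets T₀, T₊ ⊆ (0,∞), T₋ ⊆ (−∞,0), each of positive p-measure and satisfying the conditional-mean ordering m(T₋) < m(T₀) < m(T₊), there exists β ≥ 0 such that J(β) ≤ Var(T₀)·P(T₀) + (1/(γ+1))·(Var(T₊)·P(T₊) + Var(T₋)·P(T₋)) + c·(P(T₊) + P(T₋)). (This is the reduction in Theorem 2: among all communication scheduling policies satisfying Assumption 2, a symmetric threshold policy is at least as good.) -/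
open MeasureTheory Set

section tails

variable {f : ℝ → ℝ}

theorem integral_Ioi_eq_sub (hf : Integrable f) (t : ℝ) :
    ∫ x in Ioi t, f x = (∫ x in Ioi 0, f x) - ∫ x in (0 : ℝ)..t, f x := by
  have := intervalIntegral.integral_interval_add_Ioi (μ := volume) (f := f) (a := 0) (b := t)
    hf.integrableOn hf.integrableOn
  linarith

theorem continuous_integral_Ioi (hf : Integrable f) :
    Continuous fun t => ∫ x in Ioi t, f x := by
  rw [funext (integral_Ioi_eq_sub hf)]
  exact continuous_const.sub (hf.continuous_primitive 0)

theorem tendsto_integral_Ioi_atTop (hf : Integrable f) :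
    Filter.Tendsto (fun t => ∫ x in Ioi t, f x) Filter.atTop (nhds 0) := by
  rw [funext (integral_Ioi_eq_sub hf)]
  have := intervalIntegral_tendsto_integral_Ioi (μ := volume) (f := f) 0 hf.integrableOn
    Filter.tendsto_id
  simpa using this.const_sub (∫ x in Ioi 0, f x)

theorem hasDerivAt_integral_Ioi (hf : Integrable f) (hm : Measurable f) {t : ℝ}
    (hc : ContinuousAt f t) :
    HasDerivAt (fun t => ∫ x in Ioi t, f x) (-f t) t := by
  rw [funext (integral_Ioi_eq_sub hf)]
  have := intervalIntegral.integral_hasDerivAt_right (a := 0) (b := t)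
    hf.intervalIntegrable hm.stronglyMeasurable.stronglyMeasurableAtFilter hc
  simpa using this.const_sub (∫ x in Ioi 0, f x)

/-- The upper tail at `t` maximizes the first moment among sets of the same mass. -/
theorem setIntegral_id_mul_le_Ioi {p : ℝ → ℝ} (hp0 : ∀ x, 0 ≤ p x) (hp : Integrable p)
    (hp1 : Integrable fun x => x * p x) {T : Set ℝ} (hT : MeasurableSet T) {t : ℝ}
    (h : ∫ x in T, p x = ∫ x in Ioi t, p x) :
    ∫ x in T, x * p x ≤ ∫ x in Ioi t, x * p x := by
  have key : ∫ x in T, (x * p x - t * p x) ≤ ∫ x in Ioi t, (x * p x - t * p x) := by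
    have hi : Integrable fun x => x * p x - t * p x := hp1.sub (hp.const_mul t)
    rw [← integral_indicator hT, ← integral_indicator measurableSet_Ioi]
    refine integral_mono (hi.indicator hT) (hi.indicator measurableSet_Ioi) fun x => ?_
    have := hp0 x
    by_cases h1 : x ∈ T <;> by_cases h2 : x ∈ Ioi t <;>
      simp only [indicator_of_mem, indicator_of_notMem, h1, h2, not_false_eq_true, le_refl] <;>
      simp only [mem_Ioi, not_lt] at h2 <;> nlinarith
  rw [integral_sub hp1.integrableOn (hp.const_mul t).integrableOn,
    integral_sub hp1.integrableOn (hp.const_mul t).integrableOn, integral_const_mul,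
    integral_const_mul, h] at key
  linarith

/-- The lower tail at `t` minimizes the first moment among sets of the same mass. -/
theorem Iic_le_setIntegral_id_mul {p : ℝ → ℝ} (hp0 : ∀ x, 0 ≤ p x) (hp : Integrable p)
    (hp1 : Integrable fun x => x * p x) {T : Set ℝ} (hT : MeasurableSet T) {t : ℝ}
    (h : ∫ x in T, p x = ∫ x in Iic t, p x) :
    ∫ x in Iic t, x * p x ≤ ∫ x in T, x * p x := by
  have key : ∫ x in Iic t, (x * p x - t * p x) ≤ ∫ x in T, (x * p x - t * p x) := by
    have hi : Integrable fun x => x * p x - t * p x := hp1.sub (hp.const_mul t)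
    rw [← integral_indicator hT, ← integral_indicator measurableSet_Iic]
    refine integral_mono (hi.indicator measurableSet_Iic) (hi.indicator hT) fun x => ?_
    have := hp0 x
    by_cases h1 : x ∈ T <;> by_cases h2 : x ∈ Iic t <;>
      simp only [indicator_of_mem, indicator_of_notMem, h1, h2, not_false_eq_true, le_refl] <;>
      simp only [mem_Iic, not_le] at h2 <;> nlinarith
  rw [integral_sub hp1.integrableOn (hp.const_mul t).integrableOn,
    integral_sub hp1.integrableOn (hp.const_mul t).integrableOn, integral_const_mul,
    integral_const_mul, h] at key
  linarith

end tails

section symmetric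

variable {p : ℝ → ℝ}

/-- Anderson-type inequality: translating one of two even, radially decreasing functions
decreases the integral of their product. -/
theorem integral_comp_sub_mul_le {g : ℝ → ℝ} {C : ℝ} (hp : Integrable p)
    (hpe : ∀ x, p (-x) = p x) (hpa : ∀ x y, |x| ≤ |y| → p y ≤ p x)
    (hgc : Continuous g) (hgb : ∀ x, ‖g x‖ ≤ C)
    (hge : ∀ x, g (-x) = g x) (hga : ∀ x y, |x| ≤ |y| → g y ≤ g x) (a : ℝ) :
    ∫ x, g (x - a) * p x ≤ ∫ x, g x * p x := by
  have hgp : ∀ b c : ℝ, Integrable fun x => g (x - b) * p (x - c) := fun b c =>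
    (hp.comp_sub_right c).bdd_mul (by fun_prop)
      (Filter.Eventually.of_forall fun x => hgb (x - b))
  have i1 : Integrable fun x => g x * p x := by simpa using hgp 0 0
  have i2 : Integrable fun x => g (x - a) * p x := by simpa using hgp a 0
  have i3 : Integrable fun x => g x * p (x - a) := by simpa using hgp 0 a
  have i4 := hgp a a
  have hnn : 0 ≤ ∫ x,
      (g x * p x - g (x - a) * p x - (g x * p (x - a) - g (x - a) * p (x - a))) := by
    refine integral_nonneg fun x => ?_
    show 0 ≤ g x * p x - g (x - a) * p x - (g x * p (x - a) - g (x - a) * p (x - a))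
    rcases le_total |x| |x - a| with h | h
    · nlinarith [mul_nonneg (sub_nonneg.2 (hga _ _ h)) (sub_nonneg.2 (hpa _ _ h))]
    · nlinarith [mul_nonneg (sub_nonneg.2 (hga _ _ h)) (sub_nonneg.2 (hpa _ _ h))]
  rw [integral_sub (f := fun x => g x * p x - g (x - a) * p x)
      (g := fun x => g x * p (x - a) - g (x - a) * p (x - a)) (i1.sub i2) (i3.sub i4),
    integral_sub i1 i2, integral_sub i3 i4] at hnn
  have e4 : ∫ x, g (x - a) * p (x - a) = ∫ x, g x * p x :=
    integral_sub_right_eq_self (fun x => g x * p x) a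
  have e3 : ∫ x, g x * p (x - a) = ∫ x, g (x - a) * p x := by
    rw [← integral_sub_left_eq_self (fun x => g x * p (x - a)) volume a]
    refine integral_congr_ae (Filter.Eventually.of_forall fun x => ?_)
    show g (a - x) * p (a - x - a) = g (x - a) * p x
    rw [← hge, ← hpe]
    ring_nf
  linarith

/-- Among all sets of given mass, the centred interval has least unnormalized variance. -/
theorem Ioc_second_moment_le (hp0 : ∀ x, 0 ≤ p x) (hp : Integrable p)
    (hp1 : Integrable fun x => x * p x) (hp2 : Integrable fun x => x ^ 2 * p x)
    (hpe : ∀ x, p (-x) = p x) (hpa : ∀ x y, |x| ≤ |y| → p y ≤ p x)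
    {T : Set ℝ} (hT : MeasurableSet T) (hTpos : 0 < ∫ x in T, p x) {β : ℝ}
    (h : ∫ x in T, p x = ∫ x in Ioc (-β) β, p x) :
    ∫ x in Ioc (-β) β, x ^ 2 * p x ≤
      (∫ x in T, x ^ 2 * p x) - (∫ x in T, x * p x) ^ 2 / ∫ x in T, p x := by
  set a := (∫ x in T, x * p x) / ∫ x in T, p x with ha
  have hX : ∫ x in T, x * p x = a * ∫ x in T, p x := by rw [ha]; field_simp
  let g : ℝ → ℝ := fun x => max (β ^ 2 - x ^ 2) 0
  have hgc : Continuous g := by fun_prop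
  have hgb : ∀ x, ‖g x‖ ≤ β ^ 2 := fun x => by
    rw [Real.norm_eq_abs, abs_of_nonneg (le_max_right _ _)]
    exact max_le (by nlinarith [sq_nonneg x]) (sq_nonneg _)
  have hand := integral_comp_sub_mul_le (g := g) (C := β ^ 2) hp hpe hpa hgc hgb
    (fun x => by simp [g]) (fun x y hxy => by
      have := sq_le_sq.2 hxy
      exact max_le_max (by linarith) le_rfl) a
  have hq : ∀ a : ℝ, Integrable fun x => g (x - a) * p x := fun a =>
    hp.bdd_mul (c := β ^ 2) (by fun_prop) (Filter.Eventually.of_forall fun x => hgb (x - a))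
  have hi' : Integrable fun x => x ^ 2 * p x - 2 * a * (x * p x) := hp2.sub (hp1.const_mul _)
  have hi : Integrable fun x => x ^ 2 * p x - 2 * a * (x * p x) + (a ^ 2 - β ^ 2) * p x :=
    hi'.add (hp.const_mul _)
  have h1 : -∫ x, g (x - a) * p x ≤
      ∫ x in T, (x ^ 2 * p x - 2 * a * (x * p x) + (a ^ 2 - β ^ 2) * p x) := by
    rw [← integral_neg, ← integral_indicator hT]
    refine integral_mono (hq a).neg (hi.indicator hT) fun x => ?_
    have m1 : β ^ 2 - (x - a) ^ 2 ≤ g (x - a) := le_max_left _ _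
    have m2 : 0 ≤ g (x - a) := le_max_right _ _
    by_cases hx : x ∈ T
    · simp only [indicator_of_mem hx]
      nlinarith [mul_le_mul_of_nonneg_right m1 (hp0 x)]
    · simp only [indicator_of_notMem hx]
      nlinarith [mul_nonneg m2 (hp0 x)]
  have h2 : ∫ x, g x * p x = ∫ x in Ioc (-β) β, (β ^ 2 * p x - x ^ 2 * p x) := by
    rw [← integral_indicator measurableSet_Ioc]
    refine integral_congr_ae (Filter.Eventually.of_forall fun x => ?_)
    have hβ : 0 ≤ β := by
      by_contra! hβ
      rw [Ioc_eq_empty (by linarith)] at h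
      simp at h
      linarith
    by_cases hx : x ∈ Ioc (-β) β
    · simp only [indicator_of_mem hx, g]
      rw [max_eq_left (by nlinarith [hx.1, hx.2])]
      ring
    · simp only [indicator_of_notMem hx, g]
      rw [max_eq_right, zero_mul]
      rw [mem_Ioc, not_and_or, not_lt, not_le] at hx
      rcases hx with hx | hx <;> nlinarith
  rw [integral_sub (hp.const_mul _).integrableOn hp2.integrableOn, integral_const_mul] at h2
  rw [integral_add hi'.integrableOn (hp.const_mul _).integrableOn,
    integral_sub hp2.integrableOn (hp1.const_mul _).integrableOn, integral_const_mul,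
    integral_const_mul, hX] at h1
  have h3 : (a * ∫ x in T, p x) ^ 2 / ∫ x in T, p x = a ^ 2 * ∫ x in T, p x := by field_simp
  rw [hX, h3]
  rw [h] at h1 ⊢
  nlinarith

end symmetric

section logconcave

variable {p : ℝ → ℝ}

theorem antitone_abs_of_logConcave (hpos : ∀ x, 0 < p x) (heven : ∀ x, p (-x) = p x)
    (hlc : ∀ x y θ : ℝ, 0 ≤ θ → θ ≤ 1 →
      p x ^ θ * p y ^ (1 - θ) ≤ p (θ * x + (1 - θ) * y)) (x y : ℝ) (h : |x| ≤ |y|) :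
    p y ≤ p x := by
  have hseg : x ∈ segment ℝ y (-y) := by
    rw [segment_eq_uIcc, mem_uIcc]
    rw [abs_le] at h
    rcases le_total 0 y with hy | hy
    · rw [abs_of_nonneg hy] at h; right; exact h
    · rw [abs_of_nonpos hy] at h; left; constructor <;> linarith
  obtain ⟨a, b, ha, hb, hab, rfl⟩ := hseg
  have := hlc y (-y) a ha (by linarith)
  rw [heven, ← Real.rpow_add (hpos y)] at this
  obtain rfl : b = 1 - a := by linarith
  simpa using this

theorem mul_le_mul_of_logConcave (hpos : ∀ x, 0 < p x)
    (hlc : ∀ x y θ : ℝ, 0 ≤ θ → θ ≤ 1 →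
      p x ^ θ * p y ^ (1 - θ) ≤ p (θ * x + (1 - θ) * y))
    {u d e : ℝ} (hd : 0 ≤ d) (he : 0 ≤ e) :
    p u * p (u + d + e) ≤ p (u + d) * p (u + e) := by
  rcases hd.eq_or_lt with rfl | hd
  · simp
  set θ := e / (d + e) with hθ
  have h0 : 0 ≤ θ := by positivity
  have h1 : θ ≤ 1 := by rw [hθ, div_le_one (by linarith)]; linarith
  have hs : θ * (d + e) = e := by rw [hθ]; field_simp
  have A := hlc u (u + d + e) θ h0 h1
  have B := hlc (u + d + e) u θ h0 h1
  have ea : θ * u + (1 - θ) * (u + d + e) = u + d := by linear_combination -hs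
  have eb : θ * (u + d + e) + (1 - θ) * u = u + e := by linear_combination hs
  rw [ea] at A
  rw [eb] at B
  have hm := mul_le_mul A B (by have := hpos u; have := hpos (u + d + e); positivity)
    (hpos _).le
  refine le_trans (le_of_eq ?_) hm
  have e1 : p u = p u ^ θ * p u ^ (1 - θ) := by rw [← Real.rpow_add (hpos u)]; simp
  have e2 : p (u + d + e) = p (u + d + e) ^ θ * p (u + d + e) ^ (1 - θ) := by
    rw [← Real.rpow_add (hpos _)]; simp
  conv_lhs => rw [e1, e2]
  ring

/-- The mean residual life of a log-concave density is nonincreasing. -/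
theorem meanResidual_antitone (hpos : ∀ x, 0 < p x) (hp : Integrable p)
    (hp1 : Integrable fun x => x * p x)
    (hlc : ∀ x y θ : ℝ, 0 ≤ θ → θ ≤ 1 →
      p x ^ θ * p y ^ (1 - θ) ≤ p (θ * x + (1 - θ) * y))
    (hQ : ∀ t, 0 < ∫ x in Ioi t, p x) {s t : ℝ} (hst : s ≤ t) :
    (∫ x in Ioi t, x * p x) / (∫ x in Ioi t, p x) - t ≤
      (∫ x in Ioi s, x * p x) / (∫ x in Ioi s, p x) - s := by
  set b := (∫ x in Ioi s, x * p x) / (∫ x in Ioi s, p x) with hb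
  set d := t - s with hd
  set l := p (b + d) / p b with hl
  have hlb : l * p b = p (b + d) := by rw [hl]; have := hpos b; field_simp
  have shift : ∀ f : ℝ → ℝ, ∫ x in Ioi s, f (x + d) = ∫ x in Ioi t, f x := fun f => by
    have := (measurePreserving_add_right volume d).setIntegral_preimage_emb
      (measurableEmbedding_addRight d) f (Ioi t)
    rw [← this]; congr 2; ext x; simp [hd]
  have i1 : Integrable fun x => (x + d) * p (x + d) := hp1.comp_add_right d
  have i0 : Integrable fun x => p (x + d) := hp.comp_add_right d
  have key : ∫ x in Ioi s, ((x + d) * p (x + d) - (b + d) * p (x + d)) ≤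
      ∫ x in Ioi s, (l * (x * p x) - l * b * p x) := by
    refine integral_mono (i1.sub (i0.const_mul _)).integrableOn
      ((hp1.const_mul _).sub (hp.const_mul _)).integrableOn fun x => ?_
    show (x + d) * p (x + d) - (b + d) * p (x + d) ≤ l * (x * p x) - l * b * p x
    have hb0 := hpos b
    rcases le_total b x with h | h
    · have h1 : p (x + d) ≤ l * p x := by
        have := mul_le_mul_of_logConcave hpos hlc (u := b) (d := x - b) (e := d)
          (by linarith) (by linarith)
        rw [show b + (x - b) = x by ring, ← hlb] at this
        refine le_of_mul_le_mul_left (this.trans (le_of_eq ?_)) hb0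
        ring
      nlinarith
    · have h1 : l * p x ≤ p (x + d) := by
        have := mul_le_mul_of_logConcave hpos hlc (u := x) (d := b - x) (e := d)
          (by linarith) (by linarith)
        rw [show x + (b - x) = b by ring, ← hlb] at this
        refine le_of_mul_le_mul_left (le_trans (le_of_eq ?_) this) hb0
        ring
      nlinarith
  rw [integral_sub i1.integrableOn (i0.const_mul _).integrableOn,
    integral_sub (hp1.const_mul _).integrableOn (hp.const_mul _).integrableOn,
    integral_const_mul, integral_const_mul, integral_const_mul,
    shift p, shift fun x => x * p x] at key
  have hs0 := hQ s
  have hXs : ∫ x in Ioi s, x * p x = b * ∫ x in Ioi s, p x := by rw [hb]; field_simp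
  rw [hXs] at key
  have : (∫ x in Ioi t, x * p x) / (∫ x in Ioi t, p x) ≤ b + d := by
    rw [div_le_iff₀ (hQ t)]; linarith
  linarith

/-- The unnormalized tail variance, as a function of the tail mass, lies above its tangents. -/
theorem tailVariance_tangent_le (hpos : ∀ x, 0 < p x) (hmeas : Measurable p) (hp : Integrable p)
    (hp1 : Integrable fun x => x * p x) (hp2 : Integrable fun x => x ^ 2 * p x)
    (hlc : ∀ x y θ : ℝ, 0 ≤ θ → θ ≤ 1 →
      p x ^ θ * p y ^ (1 - θ) ≤ p (θ * x + (1 - θ) * y))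
    (hQ : ∀ t, 0 < ∫ x in Ioi t, p x) (hc : ∀ t, 0 < t → ContinuousAt p t) (V : ℝ → ℝ)
    (hV : ∀ β, V β = (∫ x in Ioi β, x ^ 2 * p x) -
      (∫ x in Ioi β, x * p x) ^ 2 / (∫ x in Ioi β, p x)) {β t : ℝ} (hβ : 0 ≤ β) (ht : 0 ≤ t) :
    V β + ((∫ x in Ioi β, x * p x) / (∫ x in Ioi β, p x) - β) ^ 2 *
      ((∫ x in Ioi t, p x) - ∫ x in Ioi β, p x) ≤ V t := by
  set r : ℝ → ℝ := fun t => (∫ x in Ioi t, x * p x) / (∫ x in Ioi t, p x) - t with hr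
  have hr0 : ∀ t, 0 ≤ r t := fun t => by
    have : t * ∫ x in Ioi t, p x ≤ ∫ x in Ioi t, x * p x := by
      rw [← integral_const_mul]
      exact setIntegral_mono_on (hp.const_mul t).integrableOn hp1.integrableOn
        measurableSet_Ioi fun x hx => mul_le_mul_of_nonneg_right (le_of_lt hx) (hpos x).le
    rw [hr, sub_nonneg, le_div_iff₀ (hQ t)]
    exact this
  have hra : ∀ s t, s ≤ t → r t ≤ r s := fun s t =>
    meanResidual_antitone hpos hp hp1 hlc hQ
  let K : ℝ → ℝ := fun t => ((∫ x in Ioi t, x ^ 2 * p x) -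
      (∫ x in Ioi t, x * p x) ^ 2 / (∫ x in Ioi t, p x)) - r β ^ 2 * ∫ x in Ioi t, p x
  have hKc : Continuous K :=
    ((continuous_integral_Ioi hp2).sub (((continuous_integral_Ioi hp1).pow 2).div
      (continuous_integral_Ioi hp) fun t => (hQ t).ne')).sub
      (continuous_const.mul (continuous_integral_Ioi hp))
  have hKd : ∀ t, 0 < t → HasDerivAt K ((r β ^ 2 - r t ^ 2) * p t) t := fun t ht => by
    have c0 := hc t ht
    have d0 := hasDerivAt_integral_Ioi hp hmeas c0
    have d1 := hasDerivAt_integral_Ioi hp1 (by fun_prop) (continuousAt_id.mul c0)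
    have d2 := hasDerivAt_integral_Ioi hp2 (by fun_prop) ((continuousAt_id.pow 2).mul c0)
    have := (d2.sub ((d1.pow 2).div d0 (hQ t).ne')).sub (d0.const_mul (r β ^ 2))
    refine this.congr_deriv ?_
    have hq := hQ t
    simp only [Pi.pow_apply, hr]
    field_simp
    ring
  have hmain : K β ≤ K t := by
    rcases le_total t β with h | h
    · refine antitoneOn_of_deriv_nonpos (convex_Icc t β) hKc.continuousOn ?_ ?_
        (left_mem_Icc.2 h) (right_mem_Icc.2 h) h
      · intro x hx
        rw [interior_Icc] at hx
        exact (hKd x (ht.trans_lt hx.1)).differentiableAt.differentiableWithinAt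
      · intro x hx
        rw [interior_Icc] at hx
        rw [(hKd x (ht.trans_lt hx.1)).deriv]
        have := pow_le_pow_left₀ (hr0 β) (hra x β hx.2.le) 2
        exact mul_nonpos_of_nonpos_of_nonneg (by linarith) (hpos x).le
    · refine monotoneOn_of_deriv_nonneg (convex_Icc β t) hKc.continuousOn ?_ ?_
        (left_mem_Icc.2 h) (right_mem_Icc.2 h) h
      · intro x hx
        rw [interior_Icc] at hx
        exact (hKd x (hβ.trans_lt hx.1)).differentiableAt.differentiableWithinAt
      · intro x hx
        rw [interior_Icc] at hx
        rw [(hKd x (hβ.trans_lt hx.1)).deriv]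
        have := pow_le_pow_left₀ (hr0 x) (hra β x hx.1.le) 2
        exact mul_nonneg (by linarith) (hpos x).le
  rw [hV, hV]
  simp only [K] at hmain
  show _ + r β ^ 2 * _ ≤ _
  linarith

end logconcave

/-- Replacing cell moments `X` by more spread-out moments `Y` (same masses `P`, same total)
increases the between-cell second moment. -/
theorem sum_sq_div_le_of_ordered {P0 Pp Pm X0 Xp Xm Y0 Yp Ym : ℝ} (h0 : 0 < P0) (hp : 0 < Pp)
    (hm : 0 < Pm) (ho1 : Xm / Pm ≤ X0 / P0) (ho2 : X0 / P0 ≤ Xp / Pp) (hpY : Xp ≤ Yp)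
    (hmY : Ym ≤ Xm) (hs : X0 + Xp + Xm = Y0 + Yp + Ym) :
    X0 ^ 2 / P0 + Xp ^ 2 / Pp + Xm ^ 2 / Pm ≤ Y0 ^ 2 / P0 + Yp ^ 2 / Pp + Ym ^ 2 / Pm := by
  have tangent : ∀ P X Y : ℝ, 0 < P → X ^ 2 / P + 2 * (X / P) * (Y - X) ≤ Y ^ 2 / P := by
    intro P X Y hP
    have : Y ^ 2 / P - (X ^ 2 / P + 2 * (X / P) * (Y - X)) = (Y - X) ^ 2 / P := by
      field_simp; ring
    have : 0 ≤ (Y - X) ^ 2 / P := by positivity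
    linarith
  have a := tangent P0 X0 Y0 h0
  have b := tangent Pp Xp Yp hp
  have c := tangent Pm Xm Ym hm
  have d := mul_nonneg (sub_nonneg.2 ho2) (sub_nonneg.2 hpY)
  have e := mul_nonneg (sub_nonneg.2 ho1) (sub_nonneg.2 hmY)
  have f : Y0 - X0 = (Xp - Yp) + (Xm - Ym) := by linarith
  rw [f] at a
  nlinarith

section splitting

variable {f : ℝ → ℝ}

theorem integral_eq_add_of_partition (hf : Integrable f) {A B C : Set ℝ}
    (hB : MeasurableSet B) (hC : MeasurableSet C) (hAB : Disjoint A B) (hAC : Disjoint A C)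
    (hBC : Disjoint B C) (hu : A ∪ B ∪ C = univ) :
    ∫ x, f x = (∫ x in A, f x) + (∫ x in B, f x) + ∫ x in C, f x := by
  rw [← setIntegral_univ, ← hu, setIntegral_union (hAC.union_left hBC) hC hf.integrableOn
    hf.integrableOn, setIntegral_union hAB hB hf.integrableOn hf.integrableOn]

theorem integral_eq_Ioc_add_Ioi_add_Iic (hf : Integrable f) {a b : ℝ} (hab : a ≤ b) :
    ∫ x, f x = (∫ x in Ioc a b, f x) + (∫ x in Ioi b, f x) + ∫ x in Iic a, f x := by
  refine integral_eq_add_of_partition hf measurableSet_Ioi measurableSet_Iic ?_ ?_ ?_ ?_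
  · exact disjoint_left.2 fun x hx hx' => absurd hx.2 (not_le.2 hx')
  · exact disjoint_left.2 fun x hx hx' => absurd hx.1 (not_lt.2 hx')
  · exact disjoint_left.2 fun x hx hx' => absurd (lt_of_le_of_lt hab hx) (not_lt.2 hx')
  · rw [Ioc_union_Ioi_eq_Ioi hab, union_comm, Iic_union_Ioi]

theorem setIntegral_Iic_neg_of_even (hf : ∀ x, f (-x) = f x) (t : ℝ) :
    ∫ x in Iic (-t), f x = ∫ x in Ioi t, f x := by
  rw [← integral_comp_neg_Ioi]
  simp_rw [hf]

theorem setIntegral_Iic_neg_of_odd (hf : ∀ x, f (-x) = -f x) (t : ℝ) :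
    ∫ x in Iic (-t), f x = -∫ x in Ioi t, f x := by
  rw [← integral_comp_neg_Ioi]
  simp_rw [hf]
  exact integral_neg _

theorem exists_integral_Ioi_eq (hf : Integrable f) {q : ℝ} (hq : 0 < q)
    (hq' : q ≤ ∫ x in Ioi 0, f x) : ∃ t, 0 ≤ t ∧ ∫ x in Ioi t, f x = q := by
  obtain ⟨b, hb, hb0⟩ := (((tendsto_integral_Ioi_atTop hf).eventually_lt_const hq).and
    (Filter.eventually_ge_atTop 0)).exists
  obtain ⟨t, ht, h⟩ := intermediate_value_Icc' hb0 (continuous_integral_Ioi hf).continuousOn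
    ⟨hb.le, hq'⟩
  exact ⟨t, ht.1, h⟩

end splitting

set_option maxHeartbeats 1000000 in
/-- Theorem 2 (reduction step): among all communication scheduling policies
satisfying Assumption 2, a symmetric threshold policy is at least as good. -/
theorem stmt0
    (p : ℝ → ℝ)
    (hmeas : Measurable p)
    (hnonneg : ∀ x, 0 ≤ p x)
    (hint : (∫ x, p x) = 1)
    (heven : ∀ x, p (-x) = p x)
    (hpos : ∀ x, 0 < p x)
    (hlogconcave : ∀ x y θ : ℝ, 0 ≤ θ → θ ≤ 1 →
      p x ^ θ * p y ^ (1 - θ) ≤ p (θ * x + (1 - θ) * y))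
    (hC1 : ContDiffOn ℝ 1 p (Ioi 0))
    (hmom2 : Integrable (fun x => x ^ 2 * p x))
    (γ c : ℝ) (hγ : 0 < γ) (hc : 0 < c)
    (P : Set ℝ → ℝ) (hP : ∀ S, P S = ∫ x in S, p x)
    (m : Set ℝ → ℝ) (hm : ∀ S, m S = (∫ x in S, x * p x) / P S)
    (Var : Set ℝ → ℝ)
    (hVar : ∀ S, Var S = (∫ x in S, x ^ 2 * p x) / P S - m S ^ 2)
    (V : ℝ → ℝ)
    (hV : ∀ β, V β = (∫ x in Ioi β, x ^ 2 * p x) -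
      (∫ x in Ioi β, x * p x) ^ 2 / (∫ x in Ioi β, p x))
    (J : ℝ → ℝ)
    (hJ : ∀ β, J β = 2 * (∫ x in Ioc 0 β, x ^ 2 * p x) +
      2 / (γ + 1) * V β + 2 * c * (∫ x in Ioi β, p x))
    (T0 Tp Tm : Set ℝ)
    (hT0meas : MeasurableSet T0) (hTpmeas : MeasurableSet Tp)
    (hTmmeas : MeasurableSet Tm)
    (hTpsub : Tp ⊆ Ioi 0) (hTmsub : Tm ⊆ Iio 0)
    (hd0p : Disjoint T0 Tp) (hd0m : Disjoint T0 Tm) (hdpm : Disjoint Tp Tm)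
    (hunion : T0 ∪ Tp ∪ Tm = univ)
    (hP0 : 0 < P T0) (hPp : 0 < P Tp) (hPm : 0 < P Tm)
    (horder1 : m Tm < m T0) (horder2 : m T0 < m Tp) :
    ∃ β : ℝ, 0 ≤ β ∧
      J β ≤ Var T0 * P T0 +
        1 / (γ + 1) * (Var Tp * P Tp + Var Tm * P Tm) + c * (P Tp + P Tm) := by

  have hp : Integrable p := by
    by_contra h
    rw [integral_undef h] at hint
    norm_num at hint
  have hp1 : Integrable fun x => x * p x := by
    refine (hp.add hmom2).mono' (by fun_prop) (Filter.Eventually.of_forall fun x => ?_)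
    rw [Real.norm_eq_abs, abs_mul, abs_of_nonneg (hnonneg x)]
    have h1 : |x| ≤ 1 + x ^ 2 := by
      rw [abs_le]
      constructor <;> nlinarith [sq_nonneg (x - 1), sq_nonneg (x + 1)]
    have := mul_le_mul_of_nonneg_right h1 (hnonneg x)
    simp only [Pi.add_apply]
    linarith
  have hpa := antitone_abs_of_logConcave hpos heven hlogconcave
  have hQ : ∀ t, 0 < ∫ x in Ioi t, p x := fun t => by
    rw [setIntegral_pos_iff_support_of_nonneg_ae
      (Filter.Eventually.of_forall hnonneg) hp.integrableOn]
    rw [Function.support_eq_univ (fun x => (hpos x).ne'), univ_inter]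
    simp
  have hcont : ∀ t, 0 < t → ContinuousAt p t := fun t ht =>
    hC1.continuousOn.continuousAt (Ioi_mem_nhds ht)
  have even2 : ∀ x : ℝ, (-x) ^ 2 * p (-x) = x ^ 2 * p x := fun x => by rw [heven, neg_sq]
  have odd1 : ∀ x : ℝ, -x * p (-x) = -(x * p x) := fun x => by rw [heven, neg_mul]
  have e0 := setIntegral_Iic_neg_of_even heven
  have e1 := setIntegral_Iic_neg_of_odd (f := fun x => x * p x) odd1
  have e2 := setIntegral_Iic_neg_of_even (f := fun x => x ^ 2 * p x) even2
  have split0 : ∀ s t : ℝ, 0 ≤ s → 0 ≤ t → 1 =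
      (∫ x in Ioc (-s) t, p x) + (∫ x in Ioi t, p x) + ∫ x in Ioi s, p x :=
    fun s t hs ht => by
      rw [← hint, ← e0 s, ← integral_eq_Ioc_add_Ioi_add_Iic hp (by linarith)]
  have split1 : ∀ s t : ℝ, 0 ≤ s → 0 ≤ t → ∫ x, x * p x =
      (∫ x in Ioc (-s) t, x * p x) + (∫ x in Ioi t, x * p x) - ∫ x in Ioi s, x * p x :=
    fun s t hs ht => by
      rw [sub_eq_add_neg, ← e1 s, ← integral_eq_Ioc_add_Ioi_add_Iic hp1 (by linarith)]
  have split2 : ∀ s t : ℝ, 0 ≤ s → 0 ≤ t → ∫ x, x ^ 2 * p x =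
      (∫ x in Ioc (-s) t, x ^ 2 * p x) + (∫ x in Ioi t, x ^ 2 * p x) +
        ∫ x in Ioi s, x ^ 2 * p x :=
    fun s t hs ht => by
      rw [← e2 s, ← integral_eq_Ioc_add_Ioi_add_Iic hmom2 (by linarith)]
  have part := fun {f : ℝ → ℝ} (hf : Integrable f) =>
    integral_eq_add_of_partition hf hTpmeas hTmmeas hd0p hd0m hdpm hunion
  have part0 := part hp
  have part1 := part hp1
  have part2 := part hmom2
  have halfp : P Tp ≤ ∫ x in Ioi 0, p x := by
    rw [hP]
    exact setIntegral_mono_set hp.integrableOn (Filter.Eventually.of_forall hnonneg)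
      hTpsub.eventuallyLE
  have halfm : P Tm ≤ ∫ x in Ioi 0, p x := by
    rw [hP, ← e0, neg_zero]
    exact setIntegral_mono_set hp.integrableOn (Filter.Eventually.of_forall hnonneg)
      (hTmsub.trans Iio_subset_Iic_self).eventuallyLE
  obtain ⟨t, ht0, ht⟩ := exists_integral_Ioi_eq hp hPp halfp
  obtain ⟨s, hs0, hs⟩ := exists_integral_Ioi_eq hp hPm halfm
  obtain ⟨β, hβ0, hβ⟩ := exists_integral_Ioi_eq hp (q := (P Tp + P Tm) / 2) (by linarith)
    (by linarith)
  refine ⟨β, hβ0, ?_⟩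
  have unnorm : ∀ S, 0 < P S →
      Var S * P S = (∫ x in S, x ^ 2 * p x) - (∫ x in S, x * p x) ^ 2 / P S := fun S hS => by
    rw [hVar, hm]
    field_simp
  have hmassI : ∫ x in Ioc (-s) t, p x = P T0 := by
    have := split0 s t hs0 ht0
    rw [hP T0]
    rw [hint, ← hP Tp, ← hP Tm] at part0
    linarith
  have hmassB : ∫ x in Ioc (-β) β, p x = P T0 := by
    have := split0 β β hβ0 hβ0
    rw [hP T0]
    rw [hint, ← hP Tp, ← hP Tm] at part0
    linarith
  have dT := Ioc_second_moment_le hnonneg hp hp1 hmom2 heven hpa hT0meas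
    (by rw [← hP]; exact hP0) (β := β) (by rw [hmassB, hP])
  have dI := Ioc_second_moment_le hnonneg hp hp1 hmom2 heven hpa
    (measurableSet_Ioc (a := -s) (b := t)) (by rw [hmassI]; exact hP0) (β := β)
    (by rw [hmassI, hmassB])
  rw [hmassI] at dI
  rw [← hP, ← unnorm T0 hP0] at dT
  have tan := fun {t : ℝ} => tailVariance_tangent_le hpos hmeas hp hp1 hmom2 hlogconcave hQ hcont
    V hV hβ0 (t := t)
  have hVsum : 2 * V β ≤ V t + V s := by
    have a := tan ht0
    have b := tan hs0
    rw [ht, hβ] at a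
    rw [hs, hβ] at b
    linarith
  have hYp := setIntegral_id_mul_le_Ioi hnonneg hp hp1 hTpmeas (t := t) (by rw [ht, hP])
  have hYm := Iic_le_setIntegral_id_mul hnonneg hp hp1 hTmmeas (t := -s) (by rw [e0, hs, hP])
  rw [e1] at hYm
  have hbetween := sum_sq_div_le_of_ordered hP0 hPp hPm
    (by simpa only [hm] using horder1.le) (by simpa only [hm] using horder2.le) hYp hYm
    (Y0 := ∫ x in Ioc (-s) t, x * p x) (by linarith [split1 s t hs0 ht0])
  have hVt := hV t
  have hVs := hV s
  rw [ht] at hVt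
  rw [hs] at hVs
  rw [neg_sq] at hbetween
  have hspread : (∫ x in Ioc (-β) β, x ^ 2 * p x) + 2 * V β ≤
      Var T0 * P T0 + (Var Tp * P Tp + Var Tm * P Tm) := by
    rw [unnorm T0 hP0, unnorm Tp hPp, unnorm Tm hPm]
    linarith [split2 s t hs0 ht0]
  have hcentre : 2 * ∫ x in Ioc 0 β, x ^ 2 * p x = ∫ x in Ioc (-β) β, x ^ 2 * p x := by
    have a := split2 β β hβ0 hβ0
    have b := split2 0 β le_rfl hβ0
    have c := split2 0 0 le_rfl le_rfl
    simp only [neg_zero, Ioc_self, setIntegral_empty] at b c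
    linarith
  rw [hJ, hcentre, hβ]
  set k := 1 / (γ + 1) with hk
  have hk0 : 0 ≤ k := by positivity
  have hk1 : k ≤ 1 := by rw [hk, div_le_one (by linarith)]; linarith
  rw [show 2 / (γ + 1) = 2 * k by rw [hk]; ring]
  linarith [mul_le_mul_of_nonneg_left hspread hk0,
    mul_le_mul_of_nonneg_left dT (sub_nonneg.2 hk1)]
end

section
/- Fix γ > 0 and c > 0. The fixed-point equation β² = (1/(γ+1))·G(β)² + c has exactly one solution β* in [0,∞); moreover β² − (1/(γ+1))·G(β)² − c < 0 for all β ∈ [0,β*) and β² − (1/(γ+1))·G(β)² − c > 0 for all β ∈ (β*,∞). -/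
open MeasureTheory Set

/-- A positive log-concave function satisfies the four-point (total positivity) inequality. -/
theorem logConcave_four_point {p : ℝ → ℝ} (hpos : ∀ x, 0 < p x)
    (hlogconcave : ∀ x y θ : ℝ, 0 ≤ θ → θ ≤ 1 →
      p x ^ θ * p y ^ (1 - θ) ≤ p (θ * x + (1 - θ) * y))
    {u v d : ℝ} (huv : u ≤ v) (hd : 0 < d) :
    p u * p (v + d) ≤ p (u + d) * p v := by
  have hD : 0 < v - u + d := by linarith
  obtain ⟨θ, hθ⟩ : ∃ θ, θ = d / (v - u + d) := ⟨_, rfl⟩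
  have hθ0 : 0 ≤ θ := hθ ▸ by positivity
  have hθ1 : θ ≤ 1 := by rw [hθ, div_le_one hD]; linarith
  have hθd : θ * (v - u + d) = d := by rw [hθ]; field_simp
  have h1 := hlogconcave (v + d) u θ hθ0 hθ1
  have h2 := hlogconcave u (v + d) θ hθ0 hθ1
  rw [show θ * (v + d) + (1 - θ) * u = u + d by linear_combination hθd] at h1
  rw [show θ * u + (1 - θ) * (v + d) = v by linear_combination -hθd] at h2
  have hsplit (x : ℝ) : p x ^ θ * p x ^ (1 - θ) = p x := by
    rw [← Real.rpow_add (hpos x), add_sub_cancel, Real.rpow_one]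
  have hnn (x t : ℝ) : 0 ≤ p x ^ t := Real.rpow_nonneg (hpos x).le t
  calc p u * p (v + d)
      = (p (v + d) ^ θ * p u ^ (1 - θ)) * (p u ^ θ * p (v + d) ^ (1 - θ)) := by
        linear_combination (-p (v + d)) * hsplit u -
          p u ^ θ * p u ^ (1 - θ) * hsplit (v + d)
    _ ≤ p (u + d) * p v :=
        mul_le_mul h1 h2 (mul_nonneg (hnn _ _) (hnn _ _)) (hpos _).le

theorem setIntegral_Ioi_comp_sub (f : ℝ → ℝ) (a d : ℝ) :
    ∫ x in Ioi (a + d), f (x - d) = ∫ x in Ioi a, f x := by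
  have h := (measurePreserving_sub_right volume d).setIntegral_preimage_emb
    (MeasurableEquiv.subRight d).measurableEmbedding f (Ioi a)
  simpa using h

theorem continuous_setIntegral_Ioi {f : ℝ → ℝ} (hf : Integrable f) :
    Continuous fun b => ∫ x in Ioi b, f x := by
  have h (b : ℝ) : ∫ x in Ioi b, f x = (∫ x in Ioi 0, f x) - ∫ x in (0 : ℝ)..b, f x := by
    rw [← intervalIntegral.integral_interval_add_Ioi (a := 0) (b := b) hf.integrableOn
      hf.integrableOn]
    ring
  rw [funext h]
  exact continuous_const.sub (hf.continuous_primitive 0)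

theorem setIntegral_Ioi_sub_mul {p : ℝ → ℝ} (hp : Integrable p)
    (hxp : Integrable fun x => x * p x) (b k : ℝ) :
    ∫ x in Ioi b, (x - k) * p x = (∫ x in Ioi b, x * p x) - k * ∫ x in Ioi b, p x := by
  simp_rw [sub_mul]
  rw [integral_sub hxp.integrableOn (hp.const_mul k).integrableOn, integral_const_mul]

theorem setIntegral_Ioi_pos {f : ℝ → ℝ} (hf : Integrable f) {b : ℝ}
    (hpos : ∀ x ∈ Ioi b, 0 < f x) : 0 < ∫ x in Ioi b, f x := by
  rw [setIntegral_pos_iff_support_of_nonneg_ae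
    (ae_restrict_of_forall_mem measurableSet_Ioi fun x hx => (hpos x hx).le) hf.integrableOn,
    inter_eq_right.mpr fun x hx => Function.mem_support.mpr (hpos x hx).ne']
  simp

/-- The mean excess over a threshold, `E[X | X > b] - b` for `X` of density `p`. -/
noncomputable def meanExcess (p : ℝ → ℝ) (b : ℝ) : ℝ :=
  (∫ x in Ioi b, x * p x) / (∫ x in Ioi b, p x) - b

theorem meanExcess_pos {p : ℝ → ℝ} (hpos : ∀ x, 0 < p x) (hp : Integrable p)
    (hxp : Integrable fun x => x * p x) (b : ℝ) : 0 < meanExcess p b := by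
  have hI := setIntegral_Ioi_pos hp (b := b) fun x _ => hpos x
  have h : 0 < ∫ x in Ioi b, (x - b) * p x := by
    refine setIntegral_Ioi_pos ?_ fun x hx => mul_pos (sub_pos.mpr hx) (hpos x)
    simp_rw [sub_mul]
    exact hxp.sub (hp.const_mul b)
  rw [setIntegral_Ioi_sub_mul hp hxp] at h
  rw [meanExcess, sub_pos, lt_div_iff₀ hI]
  linarith

theorem continuous_meanExcess {p : ℝ → ℝ} (hpos : ∀ x, 0 < p x) (hp : Integrable p)
    (hxp : Integrable fun x => x * p x) : Continuous (meanExcess p) :=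
  ((continuous_setIntegral_Ioi hxp).div (continuous_setIntegral_Ioi hp) fun _ =>
    (setIntegral_Ioi_pos hp fun x _ => hpos x).ne').sub continuous_id

/-- The mean excess of a log-concave density is nonincreasing. -/
theorem antitone_meanExcess {p : ℝ → ℝ} (hpos : ∀ x, 0 < p x) (hp : Integrable p)
    (hxp : Integrable fun x => x * p x)
    (hlogconcave : ∀ x y θ : ℝ, 0 ≤ θ → θ ≤ 1 →
      p x ^ θ * p y ^ (1 - θ) ≤ p (θ * x + (1 - θ) * y)) :
    Antitone (meanExcess p) := by
  intro a b hab
  rcases hab.eq_or_lt with rfl | hlt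
  · rfl
  obtain ⟨d, rfl⟩ : ∃ d, b = a + d := ⟨b - a, by ring⟩
  have hd : 0 < d := by linarith
  have hIa := setIntegral_Ioi_pos hp (b := a) fun x _ => hpos x
  have hIb := setIntegral_Ioi_pos hp (b := a + d) fun x _ => hpos x
  obtain ⟨k, hk⟩ : ∃ k, k = (∫ x in Ioi a, x * p x) / ∫ x in Ioi a, p x := ⟨_, rfl⟩
  have hzero : ∫ x in Ioi a, (x - k) * p x = 0 := by
    rw [setIntegral_Ioi_sub_mul hp hxp, hk]
    field_simp
    ring
  have hmul (l : ℝ) : Integrable fun x => (x - l) * p x := by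
    simp_rw [sub_mul]
    exact hxp.sub (hp.const_mul l)
  -- Both factors of `(x - (k + d)) * (p x - r * p (x - d))` change sign at `k + d`.
  have hpt (x : ℝ) : (x - (k + d)) * p x ≤ p (k + d) / p k * ((x - d - k) * p (x - d)) := by
    have hk0 := hpos k
    rw [div_mul_eq_mul_div, le_div_iff₀ hk0]
    rcases le_total k (x - d) with h | h
    · have h4 := logConcave_four_point hpos hlogconcave h hd
      rw [sub_add_cancel] at h4
      nlinarith [mul_le_mul_of_nonneg_left h4 (sub_nonneg.mpr h)]
    · have h4 := logConcave_four_point hpos hlogconcave h hd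
      rw [sub_add_cancel] at h4
      nlinarith [mul_le_mul_of_nonneg_left h4 (sub_nonneg.mpr h)]
  have hle : ∫ x in Ioi (a + d), (x - (k + d)) * p x ≤ 0 := by
    calc ∫ x in Ioi (a + d), (x - (k + d)) * p x
        ≤ ∫ x in Ioi (a + d), p (k + d) / p k * ((x - d - k) * p (x - d)) :=
          integral_mono (hmul _).integrableOn
            (((hmul k).comp_sub_right d).const_mul _).integrableOn hpt
      _ = 0 := by
          rw [integral_const_mul, setIntegral_Ioi_comp_sub (fun x => (x - k) * p x), hzero,
            mul_zero]
  rw [setIntegral_Ioi_sub_mul hp hxp] at hle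
  rw [meanExcess, meanExcess, ← hk, sub_le_iff_le_add, div_le_iff₀ hIb]
  linarith

theorem Integrable.id_mul_of_sq_mul {p : ℝ → ℝ} (hmeas : Measurable p) (hnonneg : ∀ x, 0 ≤ p x)
    (hp : Integrable p) (hmom2 : Integrable fun x => x ^ 2 * p x) :
    Integrable fun x => x * p x := by
  refine (hp.add hmom2).mono' (measurable_id.mul hmeas).aestronglyMeasurable
    (ae_of_all _ fun x => ?_)
  rw [Real.norm_eq_abs, abs_mul, abs_of_nonneg (hnonneg x)]
  simp only [Pi.add_apply]
  nlinarith [mul_le_mul_of_nonneg_right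
    (show |x| ≤ 1 + x ^ 2 by nlinarith [sq_nonneg (|x| - 1), sq_abs x, abs_nonneg x])
    (hnonneg x)]

/-- The fixed-point equation β² = (1/(γ+1))·G(β)² + c has exactly one
solution β* in [0,∞), with the stated sign pattern of β² − (1/(γ+1))G(β)² − c
below and above β*. -/
theorem stmt2
    (p : ℝ → ℝ)
    (hmeas : Measurable p)
    (hnonneg : ∀ x, 0 ≤ p x)
    (hint : (∫ x, p x) = 1)
    (heven : ∀ x, p (-x) = p x)
    (hpos : ∀ x, 0 < p x)
    (hlogconcave : ∀ x y θ : ℝ, 0 ≤ θ → θ ≤ 1 →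
      p x ^ θ * p y ^ (1 - θ) ≤ p (θ * x + (1 - θ) * y))
    (hC1 : ContDiffOn ℝ 1 p (Ioi 0))
    (hmom2 : Integrable (fun x => x ^ 2 * p x))
    (γ c : ℝ) (hγ : 0 < γ) (hc : 0 < c)
    (G : ℝ → ℝ)
    (hG : ∀ β, G β = (∫ x in Ioi β, x * p x) / (∫ x in Ioi β, p x) - β) :
    ∃ βstar : ℝ, 0 ≤ βstar ∧
      βstar ^ 2 = 1 / (γ + 1) * G βstar ^ 2 + c ∧
      (∀ β : ℝ, 0 ≤ β → β ^ 2 = 1 / (γ + 1) * G β ^ 2 + c → β = βstar) ∧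
      (∀ β : ℝ, 0 ≤ β → β < βstar → β ^ 2 - 1 / (γ + 1) * G β ^ 2 - c < 0) ∧
      (∀ β : ℝ, βstar < β → 0 < β ^ 2 - 1 / (γ + 1) * G β ^ 2 - c) := by
  have hp : Integrable p := integrable_of_integral_eq_one hint
  have hxp := Integrable.id_mul_of_sq_mul hmeas hnonneg hp hmom2
  obtain rfl : G = meanExcess p := funext hG
  have hGpos := meanExcess_pos hpos hp hxp
  have hGanti := antitone_meanExcess hpos hp hxp hlogconcave
  have hGcont := continuous_meanExcess hpos hp hxp
  have hκ : 0 < 1 / (γ + 1) := by positivity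
  obtain ⟨κ, hκdef⟩ : ∃ κ, κ = 1 / (γ + 1) := ⟨_, rfl⟩
  rw [← hκdef] at hκ ⊢
  obtain ⟨F, hF⟩ : ∃ F : ℝ → ℝ, F = fun β => β ^ 2 - κ * meanExcess p β ^ 2 - c := ⟨_, rfl⟩
  have hFcont : Continuous F := by rw [hF]; fun_prop
  have hFmono : StrictMonoOn F (Ici 0) := by
    intro a ha b _ hab
    have hsq : a ^ 2 < b ^ 2 := pow_lt_pow_left₀ hab ha two_ne_zero
    have hGsq : κ * meanExcess p b ^ 2 ≤ κ * meanExcess p a ^ 2 :=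
      mul_le_mul_of_nonneg_left (pow_le_pow_left₀ (hGpos b).le (hGanti hab.le) 2) hκ.le
    simp only [hF]
    linarith
  have hF0 : F 0 ≤ 0 := by
    simp only [hF]
    nlinarith [mul_pos hκ (pow_pos (hGpos 0) 2)]
  obtain ⟨B, hB⟩ : ∃ B, B = 1 + κ * meanExcess p 0 ^ 2 + c := ⟨_, rfl⟩
  have hB1 : 1 ≤ B := by
    nlinarith [mul_pos hκ (pow_pos (hGpos 0) 2)]
  have hFB : 0 ≤ F B := by
    have hGsq : κ * meanExcess p B ^ 2 ≤ κ * meanExcess p 0 ^ 2 :=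
      mul_le_mul_of_nonneg_left
        (pow_le_pow_left₀ (hGpos B).le (hGanti (zero_le_one.trans hB1)) 2) hκ.le
    simp only [hF]
    nlinarith
  obtain ⟨s, ⟨hs0, -⟩, hs⟩ := intermediate_value_Icc (zero_le_one.trans hB1)
    hFcont.continuousOn ⟨hF0, hFB⟩
  have hFdef (β : ℝ) : β ^ 2 - κ * meanExcess p β ^ 2 - c = F β := by rw [hF]
  refine ⟨s, hs0, by linarith [hFdef s], fun β hβ h => ?_, fun β hβ h => ?_, fun β h => ?_⟩
  · exact hFmono.injOn hβ hs0 (by linarith [hFdef β])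
  · rw [hFdef, ← hs]
    exact hFmono hβ hs0 h
  · rw [hFdef, ← hs]
    exact hFmono hs0 (hs0.trans h.le) h
end

section
/- Fix γ > 0 and c > 0, and define J(β) = 2∫_0^β x² p(x) dx + (2/(γ+1))·V(β) + 2c·∫_β^∞ p(x) dx, where V(β) = ∫_β^∞ x² p(x) dx − (∫_β^∞ x p(x) dx)²/(∫_β^∞ p(x) dx). Then for every β > 0, J is differentiable at β with derivative J′(β) = 2·p(β)·(β² − (1/(γ+1))·G(β)² − c). -/
open MeasureTheory Set

theorem hasDerivAt_integral_Ioi_of_continuousAt {f : ℝ → ℝ} {β : ℝ}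
    (hf : Integrable f) (hmeas : Measurable f) (hcont : ContinuousAt f β) :
    HasDerivAt (fun b => ∫ x in Ioi b, f x) (-f β) β := by
  have hderiv : HasDerivAt (fun b => ∫ x in β..b, f x) (f β) β :=
    intervalIntegral.integral_hasDerivAt_right hf.intervalIntegrable
      hmeas.stronglyMeasurable.stronglyMeasurableAtFilter hcont
  refine (hderiv.const_sub (∫ x in Ioi β, f x)).congr_of_eventuallyEq (.of_forall fun b => ?_)
  have := intervalIntegral.integral_Ioi_sub_Ioi' (f := f) (a := β) (b := b) (μ := volume)
    hf.integrableOn hf.integrableOn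
  dsimp only
  linarith

theorem hasDerivAt_integral_Ioc_of_continuousAt {f : ℝ → ℝ} {a β : ℝ} (hab : a < β)
    (hf : Integrable f) (hmeas : Measurable f) (hcont : ContinuousAt f β) :
    HasDerivAt (fun b => ∫ x in Ioc a b, f x) (f β) β := by
  have hderiv : HasDerivAt (fun b => ∫ x in a..b, f x) (f β) β :=
    intervalIntegral.integral_hasDerivAt_right hf.intervalIntegrable
      hmeas.stronglyMeasurable.stronglyMeasurableAtFilter hcont
  refine hderiv.congr_of_eventuallyEq ?_
  filter_upwards [Ioi_mem_nhds hab] with b hb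
  exact (intervalIntegral.integral_of_le hb.le).symm

/-- Derivative of the one-stage cost: for β > 0,
J′(β) = 2 p(β) (β² − (1/(γ+1)) G(β)² − c). -/
theorem stmt3
    (p : ℝ → ℝ)
    (hmeas : Measurable p)
    (hnonneg : ∀ x, 0 ≤ p x)
    (hint : (∫ x, p x) = 1)
    (heven : ∀ x, p (-x) = p x)
    (hpos : ∀ x, 0 < p x)
    (hcont : ContinuousOn p (Ioi 0))
    (hmom2 : Integrable (fun x => x ^ 2 * p x))
    (γ c : ℝ) (hγ : 0 < γ) (hc : 0 < c)
    (G : ℝ → ℝ)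
    (hG : ∀ β, G β = (∫ x in Ioi β, x * p x) / (∫ x in Ioi β, p x) - β)
    (V : ℝ → ℝ)
    (hV : ∀ β, V β = (∫ x in Ioi β, x ^ 2 * p x) -
      (∫ x in Ioi β, x * p x) ^ 2 / (∫ x in Ioi β, p x))
    (J : ℝ → ℝ)
    (hJ : ∀ β, J β = 2 * (∫ x in Ioc 0 β, x ^ 2 * p x) +
      2 / (γ + 1) * V β + 2 * c * (∫ x in Ioi β, p x)) :
    ∀ β : ℝ, 0 < β →
      HasDerivAt J (2 * p β * (β ^ 2 - 1 / (γ + 1) * G β ^ 2 - c)) β := by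
  intro β hβ
  have hmom0 : Integrable p := by
    by_contra h
    simp [integral_undef h] at hint
  have hmeas1 : Measurable fun x => x * p x := measurable_id.mul hmeas
  have hmeas2 : Measurable fun x => x ^ 2 * p x := (measurable_id.pow_const 2).mul hmeas
  have hmom1 : Integrable fun x => x * p x := by
    refine (hmom0.add hmom2).mono' hmeas1.aestronglyMeasurable (.of_forall fun x => ?_)
    have hx : |x| ≤ 1 + x ^ 2 := by nlinarith [sq_nonneg (|x| - 1), sq_abs x, abs_nonneg x]
    calc ‖x * p x‖ = |x| * p x := by rw [norm_mul, Real.norm_eq_abs, Real.norm_of_nonneg (hnonneg x)]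
      _ ≤ (1 + x ^ 2) * p x := mul_le_mul_of_nonneg_right hx (hnonneg x)
      _ = p x + x ^ 2 * p x := by ring
  have hp : ContinuousAt p β := hcont.continuousAt (Ioi_mem_nhds hβ)
  have hp1 : ContinuousAt (fun x => x * p x) β := continuousAt_id.mul hp
  have hp2 : ContinuousAt (fun x => x ^ 2 * p x) β := (continuousAt_id.pow 2).mul hp
  have hB : 0 < ∫ x in Ioi β, p x := by
    rw [setIntegral_pos_iff_support_of_nonneg_ae (.of_forall hnonneg) hmom0.integrableOn,
      Function.support_eq_univ fun x => (hpos x).ne', univ_inter, Real.volume_Ioi]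
    exact ENNReal.zero_lt_top
  have d0 := hasDerivAt_integral_Ioi_of_continuousAt hmom0 hmeas hp
  have d1 := hasDerivAt_integral_Ioi_of_continuousAt hmom1 hmeas1 hp1
  have d2 := hasDerivAt_integral_Ioi_of_continuousAt hmom2 hmeas2 hp2
  have dc := hasDerivAt_integral_Ioc_of_continuousAt hβ hmom2 hmeas2 hp2
  have hJ' : J = fun β => 2 * (∫ x in Ioc 0 β, x ^ 2 * p x) +
      2 / (γ + 1) * ((∫ x in Ioi β, x ^ 2 * p x) -
      (∫ x in Ioi β, x * p x) ^ 2 / (∫ x in Ioi β, p x)) + 2 * c * (∫ x in Ioi β, p x) := by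
    ext b
    rw [hJ, hV]
  rw [hJ', hG]
  refine (((dc.const_mul 2).add ((d2.sub ((d1.pow 2).div d0 hB.ne')).const_mul
    (2 / (γ + 1)))).add (d0.const_mul (2 * c))).congr_deriv ?_
  have hγ1 : γ + 1 ≠ 0 := by positivity
  simp only [Pi.pow_apply]
  field_simp
  ring
end

section
/- For every measurable partition of ℝ into sets T₀, T₊ ⊆ (0,∞), T₋ ⊆ (−∞,0), each of positive p-measure and satisfying the conditional-mean ordering m(T₋) < m(T₀) < m(T₊), there exists β > 0 such that, setting T₀′ = (−β,β), T₊′ = (β,∞), T₋′ = (−∞,−β), one has P(T₀′) = P(T₀) and Var(T₀′)·P(T₀′) + Var(T₊′)·P(T₊′) + Var(T₋′)·P(T₋′) ≤ Var(T₀)·P(T₀) + Var(T₊)·P(T₊) + Var(T₋)·P(T₋). (Proposition 1: a symmetric threshold partition with the same non-transmission probability has no larger three-level quantizer distortion.) -/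
open MeasureTheory Set

section

open Filter Topology

theorem split_le {G Q : ℝ → ℝ}
    (hG : ∀ a ∈ Ioo (0 : ℝ) 1, HasDerivAt G (Q a) a)
    (hQ0 : ∀ a ∈ Ioc (0 : ℝ) (1 / 2), 0 ≤ Q a)
    (hres : ∀ a b, 0 < b → b ≤ a → a ≤ 1 / 2 → G b / b - Q b ≤ G a / a - Q a)
    (hres0 : ∀ a ∈ Ioo (0 : ℝ) 1, 0 ≤ G a / a - Q a)
    (hmid : ∀ a b, 0 < b → b ≤ a → a ≤ 1 / 2 → a + b < 1 →
      (Q a - Q b) / 2 ≤ (G b - G a) / (1 - a - b))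
    {a b : ℝ} (hb : 0 < b) (hba : b ≤ a) (ha : a ≤ 1 / 2) (hab : a + b < 1) :
    G a ^ 2 / a + G b ^ 2 / b + (G a - G b) ^ 2 / (1 - a - b) ≤
      2 * (G ((a + b) / 2) ^ 2 / ((a + b) / 2)) := by
  set c := a + b with hc
  let h : ℝ → ℝ := fun s => G s ^ 2 / s + G (c - s) ^ 2 / (c - s) + (G s - G (c - s)) ^ 2 / (1 - c)
  have hd : ∀ s ∈ Icc (c / 2) a, HasDerivAt h
      ((2 * G s * Q s * s - G s ^ 2) / s ^ 2 +
        (-(2 * G (c - s) * Q (c - s) * (c - s)) + G (c - s) ^ 2) / (c - s) ^ 2 +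
        2 * (G s - G (c - s)) * (Q s + Q (c - s)) / (1 - c)) s := by
    rintro s ⟨hs1, hs2⟩
    have h1 := hG s ⟨by linarith, by linarith⟩
    have h2 : HasDerivAt (fun s => G (c - s)) (-(Q (c - s))) s := by
      have := (hG (c - s) ⟨by linarith, by linarith⟩).comp s ((hasDerivAt_id s).const_sub c)
      simpa [Function.comp_def] using this
    have h3 : HasDerivAt (fun s => c - s) (-1) s := (hasDerivAt_id s).const_sub c
    have e1 := (h1.pow 2).div (hasDerivAt_id s) (by simp; linarith)
    have e2 := (h2.pow 2).div h3 (by linarith)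
    have e3 := ((h1.sub h2).pow 2).div_const (1 - c)
    refine ((e1.add e2).add e3).congr_deriv ?_
    simp only [id, Pi.pow_apply, Pi.sub_apply]
    ring
  have hanti : AntitoneOn h (Icc (c / 2) a) := by
    apply antitoneOn_of_deriv_nonpos (convex_Icc _ _)
    · exact fun s hs => (hd s hs).continuousAt.continuousWithinAt
    · intro s hs
      exact (hd s (interior_subset hs)).differentiableAt.differentiableWithinAt
    · intro s hs
      have hs := interior_subset hs
      rw [(hd s hs).deriv]
      obtain ⟨hs1, hs2⟩ := hs
      have k1 := hres s (c - s) (by linarith) (by linarith) (by linarith)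
      have k2 := hres0 (c - s) ⟨by linarith, by linarith⟩
      have k3 := hmid s (c - s) (by linarith) (by linarith) (by linarith) (by linarith)
      have q1 := hQ0 s ⟨by linarith, by linarith⟩
      have q2 := hQ0 (c - s) ⟨by linarith, by linarith⟩
      rw [show 1 - s - (c - s) = 1 - c by ring] at k3
      have n1 : s ≠ 0 := by linarith
      have n2 : c - s ≠ 0 := by linarith
      set x := G s / s with hx
      set y := G (c - s) / (c - s) with hy
      set z := (G (c - s) - G s) / (1 - c) with hz
      have : (2 * G s * Q s * s - G s ^ 2) / s ^ 2 +
        (-(2 * G (c - s) * Q (c - s) * (c - s)) + G (c - s) ^ 2) / (c - s) ^ 2 +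
        2 * (G s - G (c - s)) * (Q s + Q (c - s)) / (1 - c) =
        ((y - Q (c - s)) ^ 2 - (x - Q s) ^ 2) + (Q s + Q (c - s)) * (Q s - Q (c - s) - 2 * z) := by
        have t1 : (2 * G s * Q s * s - G s ^ 2) / s ^ 2 = 2 * x * Q s - x ^ 2 := by
          rw [hx]; field_simp
        have t2 : (-(2 * G (c - s) * Q (c - s) * (c - s)) + G (c - s) ^ 2) / (c - s) ^ 2
            = -(2 * y * Q (c - s)) + y ^ 2 := by
          rw [hy]; field_simp
        have t3 : 2 * (G s - G (c - s)) * (Q s + Q (c - s)) / (1 - c) =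
            -2 * z * (Q s + Q (c - s)) := by rw [hz]; ring
        rw [t1, t2, t3]; ring
      rw [this]
      have r1 : (y - Q (c - s)) ^ 2 ≤ (x - Q s) ^ 2 := by gcongr
      have r2 : (Q s + Q (c - s)) * (Q s - Q (c - s) - 2 * z) ≤ 0 :=
        mul_nonpos_of_nonneg_of_nonpos (by linarith) (by linarith)
      linarith
  have := hanti ⟨le_rfl, by linarith⟩ ⟨by linarith, le_rfl⟩ (show c / 2 ≤ a by linarith)
  simp only [h] at this
  rw [show c - a = b by rw [hc]; ring, show c - c / 2 = c / 2 by ring] at this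
  rw [show 1 - a - b = 1 - c by rw [hc]; ring]
  refine this.trans (le_of_eq ?_)
  rw [sub_self]; ring

theorem sq_div_add_le {u v U V a b c : ℝ} (ha : 0 < a) (hb : 0 < b) (hc : 0 < c)
    (huU : u ≤ U) (hvV : v ≤ V) (h1 : -v / b ≤ (v - u) / c) (h2 : (v - u) / c ≤ u / a) :
    u ^ 2 / a + v ^ 2 / b + (u - v) ^ 2 / c ≤ U ^ 2 / a + V ^ 2 / b + (U - V) ^ 2 / c := by
  have key : U ^ 2 / a + V ^ 2 / b + (U - V) ^ 2 / c - (u ^ 2 / a + v ^ 2 / b + (u - v) ^ 2 / c)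
      = (U - u) ^ 2 / a + (V - v) ^ 2 / b + ((U - u) - (V - v)) ^ 2 / c
        + 2 * (U - u) * (u / a - (v - u) / c) + 2 * (V - v) * ((v - u) / c - -v / b) := by
    ring
  have p1 : 0 ≤ 2 * (U - u) * (u / a - (v - u) / c) :=
    mul_nonneg (by linarith) (by linarith)
  have p2 : 0 ≤ 2 * (V - v) * ((v - u) / c - -v / b) :=
    mul_nonneg (by linarith) (by linarith)
  have p3 : 0 ≤ (U - u) ^ 2 / a + (V - v) ^ 2 / b + ((U - u) - (V - v)) ^ 2 / c := by positivity
  linarith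

theorem mul_le_mul_of_log_concave {p : ℝ → ℝ} (hpos : ∀ x, 0 < p x)
    (hlc : ∀ x y θ : ℝ, 0 ≤ θ → θ ≤ 1 → p x ^ θ * p y ^ (1 - θ) ≤ p (θ * x + (1 - θ) * y))
    {a b r s : ℝ} (hab : a ≤ b) (hrs : r ≤ s) :
    p (b + s) * p (a + r) ≤ p (a + s) * p (b + r) := by
  rcases eq_or_lt_of_le hrs with rfl | hrs
  · exact (mul_comm _ _).le
  have hD : 0 < b - a + (s - r) := by linarith
  set θ := (s - r) / (b - a + (s - r)) with hθ
  have hθ0 : 0 ≤ θ := div_nonneg (by linarith) hD.le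
  have hθ1 : θ ≤ 1 := (div_le_one hD).2 (by linarith)
  have hmul : θ * (b - a + (s - r)) = s - r := div_mul_cancel₀ _ hD.ne'
  have h1 := hlc (b + s) (a + r) θ hθ0 hθ1
  have h2 := hlc (b + s) (a + r) (1 - θ) (by linarith) (by linarith)
  rw [show θ * (b + s) + (1 - θ) * (a + r) = a + s by linear_combination hmul] at h1
  rw [show (1 - θ) * (b + s) + (1 - (1 - θ)) * (a + r) = b + r by linear_combination -hmul] at h2
  refine le_trans (le_of_eq ?_) (mul_le_mul h1 h2
    (mul_pos (Real.rpow_pos_of_pos (hpos _) _) (Real.rpow_pos_of_pos (hpos _) _)).le (hpos _).le)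
  have e1 : p (b + s) = p (b + s) ^ θ * p (b + s) ^ (1 - θ) := by
    rw [← Real.rpow_add (hpos _)]; simp
  have e2 : p (a + r) = p (a + r) ^ (1 - θ) * p (a + r) ^ (1 - (1 - θ)) := by
    rw [← Real.rpow_add (hpos _)]; simp
  conv_lhs => rw [e1, e2]
  ring

theorem le_of_abs_le_of_log_concave {p : ℝ → ℝ} (hpos : ∀ x, 0 < p x)
    (heven : ∀ x, p (-x) = p x)
    (hlc : ∀ x y θ : ℝ, 0 ≤ θ → θ ≤ 1 → p x ^ θ * p y ^ (1 - θ) ≤ p (θ * x + (1 - θ) * y))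
    {x y : ℝ} (hxy : |x| ≤ |y|) : p y ≤ p x := by
  have habs : ∀ x, p |x| = p x := fun x => by
    rcases abs_choice x with h | h <;> simp [h, heven]
  have h := mul_le_mul_of_log_concave hpos hlc (a := 0) (b := |y| - |x|) (r := -|y|) (s := |x|)
    (by linarith) (by linarith [abs_nonneg x, abs_nonneg y])
  rw [sub_add_cancel, zero_add, zero_add, show |y| - |x| + -|y| = -|x| by ring, heven, heven,
    habs, habs] at h
  exact (mul_self_le_mul_self_iff (hpos y).le (hpos x).le).2 h

variable {p : ℝ → ℝ}

theorem setIntegral_sub_mul (hi : Integrable p) (hi1 : Integrable fun x => x * p x)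
    (S : Set ℝ) (c : ℝ) :
    ∫ x in S, (x - c) * p x = (∫ x in S, x * p x) - c * ∫ x in S, p x := by
  rw [← integral_const_mul, ← integral_sub hi1.integrableOn (hi.integrableOn.const_mul c)]
  congr 1; ext x; ring

theorem integrable_sub_mul (hi : Integrable p) (hi1 : Integrable fun x => x * p x) (c : ℝ) :
    Integrable fun x => (x - c) * p x := by
  have := hi1.sub (hi.const_mul c)
  refine this.congr (.of_forall fun x => ?_)
  simp only [Pi.sub_apply]; ring

theorem setIntegral_sub_mul_le_Ioi (hpos : ∀ x, 0 < p x) (hi : Integrable p)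
    (hi1 : Integrable fun x => x * p x) {S : Set ℝ} (hS : MeasurableSet S) (c : ℝ) :
    ∫ x in S, (x - c) * p x ≤ ∫ x in Ioi c, (x - c) * p x := by
  have h := integrable_sub_mul hi hi1 c
  rw [← integral_indicator hS, ← integral_indicator measurableSet_Ioi]
  refine integral_mono (h.indicator hS) (h.indicator measurableSet_Ioi) fun x => ?_
  have := hpos x
  by_cases h1 : x ∈ S <;> by_cases h2 : x ∈ Ioi c <;>
    simp only [h1, h2, indicator_of_mem, indicator_of_notMem, not_false_eq_true, le_refl]
  · rw [mem_Ioi, not_lt] at h2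
    exact mul_nonpos_of_nonpos_of_nonneg (sub_nonpos.2 h2) this.le
  · rw [mem_Ioi] at h2
    exact mul_nonneg (sub_nonneg.2 h2.le) this.le

theorem setIntegral_pos_of_pos (hpos : ∀ x, 0 < p x) (hi : Integrable p) {S : Set ℝ}
    (hS : 0 < volume S) : 0 < ∫ x in S, p x := by
  rw [setIntegral_pos_iff_support_of_nonneg_ae (.of_forall fun x => (hpos x).le) hi.integrableOn]
  rwa [show Function.support p = univ from eq_univ_of_forall fun x => (hpos x).ne', univ_inter]

theorem setIntegral_Ioi_comp_add (f : ℝ → ℝ) (c : ℝ) :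
    ∫ x in Ioi 0, f (c + x) = ∫ x in Ioi c, f x := by
  have := (measurePreserving_add_left volume c).setIntegral_preimage_emb
    (measurableEmbedding_addLeft c) f (Ioi c)
  simpa using this

theorem mean_residual_antitone (hpos : ∀ x, 0 < p x) (hi : Integrable p)
    (hi1 : Integrable fun x => x * p x)
    (hlc : ∀ x y θ : ℝ, 0 ≤ θ → θ ≤ 1 → p x ^ θ * p y ^ (1 - θ) ≤ p (θ * x + (1 - θ) * y))
    {a b : ℝ} (hab : a ≤ b) :
    (∫ x in Ioi b, x * p x) / (∫ x in Ioi b, p x) - b ≤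
      (∫ x in Ioi a, x * p x) / (∫ x in Ioi a, p x) - a := by
  have hNa : 0 < ∫ x in Ioi a, p x := setIntegral_pos_of_pos hpos hi (by simp)
  have hNb : 0 < ∫ x in Ioi b, p x := setIntegral_pos_of_pos hpos hi (by simp)
  set s₀ := (∫ x in Ioi a, x * p x) / (∫ x in Ioi a, p x) - a with hs₀
  have hshift : ∀ c, ∫ s in Ioi 0, (s - s₀) * p (c + s) =
      (∫ x in Ioi c, x * p x) - (c + s₀) * ∫ x in Ioi c, p x := fun c => by
    rw [← setIntegral_sub_mul hi hi1,
      ← setIntegral_Ioi_comp_add (fun x => (x - (c + s₀)) * p x) c]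
    congr 1; ext x; ring_nf
  have hint : ∀ c, Integrable fun s => (s - s₀) * p (c + s) := fun c => by
    refine ((integrable_sub_mul hi hi1 (c + s₀)).comp_add_left c).congr (.of_forall fun x => ?_)
    simp only; ring_nf
  have hzero : ∫ s in Ioi 0, (s - s₀) * p (a + s) = 0 := by
    rw [hshift, hs₀, add_sub_cancel, div_mul_cancel₀ _ hNa.ne', sub_self]
  have hle : p (a + s₀) * ∫ s in Ioi 0, (s - s₀) * p (b + s) ≤
      p (b + s₀) * ∫ s in Ioi 0, (s - s₀) * p (a + s) := by
    rw [← integral_const_mul, ← integral_const_mul]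
    refine integral_mono ((hint b).integrableOn.const_mul _) ((hint a).integrableOn.const_mul _)
      fun s => ?_
    simp only
    rcases le_total s s₀ with h | h
    · have := mul_le_mul_of_log_concave hpos hlc hab h
      nlinarith
    · have := mul_le_mul_of_log_concave hpos hlc hab h
      nlinarith
  rw [hzero, mul_zero] at hle
  have h := nonpos_of_mul_nonpos_right hle (hpos _)
  rw [hshift] at h
  rw [sub_le_iff_le_add, div_le_iff₀ hNb]
  linarith

theorem midpoint_le (hpos : ∀ x, 0 < p x) (heven : ∀ x, p (-x) = p x) (hi : Integrable p)
    (hi1 : Integrable fun x => x * p x)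
    (hlc : ∀ x y θ : ℝ, 0 ≤ θ → θ ≤ 1 → p x ^ θ * p y ^ (1 - θ) ≤ p (θ * x + (1 - θ) * y))
    {a b : ℝ} (hab : a ≤ b) :
    0 ≤ ∫ x in Icc (-b) a, (x - (a - b) / 2) * p x := by
  have hf := integrable_sub_mul hi hi1 ((a - b) / 2)
  have hrefl := (Measure.measurePreserving_sub_left volume (a - b)).setIntegral_preimage_emb
    (measurableEmbedding_subLeft (a - b)) (fun x => (x - (a - b) / 2) * p x) (Icc (-b) a)
  rw [preimage_const_sub_Icc, show a - b - a = -b by ring, show a - b - -b = a by ring] at hrefl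
  have hadd : 0 ≤ (∫ x in Icc (-b) a, (x - (a - b) / 2) * p x) +
      ∫ x in Icc (-b) a, ((a - b - x) - (a - b) / 2) * p (a - b - x) := by
    rw [← integral_add hf.integrableOn (hf.comp_sub_left (a - b)).integrableOn]
    refine integral_nonneg fun x => ?_
    simp only [Pi.zero_apply]
    rcases le_total x ((a - b) / 2) with h | h
    · have : p x ≤ p (a - b - x) :=
        le_of_abs_le_of_log_concave hpos heven hlc (sq_le_sq.1 (by nlinarith))
      nlinarith
    · have : p (a - b - x) ≤ p x :=
        le_of_abs_le_of_log_concave hpos heven hlc (sq_le_sq.1 (by nlinarith))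
      nlinarith
  linarith

theorem integral_Iio_neg_of_even (heven : ∀ x, p (-x) = p x) (c : ℝ) :
    ∫ x in Iio (-c), p x = ∫ x in Ioi c, p x := by
  have h := integral_comp_neg_Ioi c p
  rw [show (fun x => p (-x)) = p from funext heven] at h
  rw [← integral_Iic_eq_integral_Iio]
  linarith

theorem integral_Iio_neg_mul_of_even (heven : ∀ x, p (-x) = p x) (c : ℝ) :
    ∫ x in Iio (-c), x * p x = -∫ x in Ioi c, x * p x := by
  have h := integral_comp_neg_Ioi c fun x => x * p x
  rw [show (fun x => -x * p (-x)) = fun x => -(x * p x) from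
    funext fun x => by rw [heven, neg_mul], integral_neg] at h
  rw [← integral_Iic_eq_integral_Iio]
  linarith

theorem integral_Iio_add_Icc_add_Ioi {f : ℝ → ℝ} (hf : Integrable f) {a b : ℝ} (hab : a ≤ b) :
    (∫ x in Iio a, f x) + (∫ x in Icc a b, f x) + (∫ x in Ioi b, f x) = ∫ x, f x := by
  rw [← setIntegral_union (by rw [Set.disjoint_left]; simp; intros; linarith) measurableSet_Icc
    hf.integrableOn hf.integrableOn, Iio_union_Icc_eq_Iic hab]
  exact intervalIntegral.integral_Iic_add_Ioi hf.integrableOn hf.integrableOn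

theorem exists_upper_quantile (hi : Integrable p) (hint : ∫ x, p x = 1)
    {a : ℝ} (ha : a ∈ Ioo (0 : ℝ) 1) : ∃ q, ∫ x in Ioi q, p x = a := by
  have hcdf : ∀ q, (∫ x in Ioi q, p x) = (∫ x in Ioi 0, p x) - ∫ x in (0 : ℝ)..q, p x := fun q => by
    rw [← intervalIntegral.integral_Ioi_sub_Ioi' hi.integrableOn hi.integrableOn]; ring
  have hcont : Continuous fun q => ∫ x in Ioi q, p x := by
    rw [funext hcdf]
    exact continuous_const.sub
      (intervalIntegral.continuous_primitive (fun _ _ => hi.intervalIntegrable) 0)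
  have htop : Tendsto (fun q => ∫ x in Ioi q, p x) atTop (𝓝 0) :=
    tendsto_integral_Ioi_zero tendsto_id
  have hbot : Tendsto (fun q => ∫ x in Ioi q, p x) atBot (𝓝 1) := by
    rw [funext hcdf]
    have h := (intervalIntegral_tendsto_integral_Iic 0 hi.integrableOn
      (tendsto_id (α := ℝ) (x := atBot))).const_add (∫ x in Ioi 0, p x)
    rw [add_comm, intervalIntegral.integral_Iic_add_Ioi hi.integrableOn hi.integrableOn, hint] at h
    refine h.congr fun q => ?_
    rw [intervalIntegral.integral_symm, id, ← sub_eq_add_neg]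
  obtain ⟨x, hx⟩ := ((tendsto_order.1 htop).2 a ha.1).exists
  obtain ⟨y, hy⟩ := ((tendsto_order.1 hbot).1 a ha.2).exists
  exact mem_range_of_exists_le_of_exists_ge hcont ⟨x, hx.le⟩ ⟨y, hy.le⟩

theorem upperMass_strictAnti (hpos : ∀ x, 0 < p x) (hi : Integrable p) :
    StrictAnti fun q => ∫ x in Ioi q, p x := by
  intro a b hab
  have h := intervalIntegral.integral_Ioi_sub_Ioi (hi.integrableOn (s := Ioi a)) hab.le
  have h2 : 0 < ∫ x in a..b, p x := by
    rw [intervalIntegral.integral_of_le hab.le]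
    exact setIntegral_pos_of_pos hpos hi (by simpa using hab)
  simp only
  linarith

theorem quantile_continuousAt {N Q : ℝ → ℝ} (hN : StrictAnti N)
    (hQ : ∀ a ∈ Ioo (0 : ℝ) 1, N (Q a) = a) {a : ℝ} (ha : a ∈ Ioo (0 : ℝ) 1) :
    ContinuousAt Q a := by
  have hev : ∀ᶠ s in 𝓝 a, s ∈ Ioo (0 : ℝ) 1 := Ioo_mem_nhds ha.1 ha.2
  refine tendsto_order.2 ⟨fun x hx => ?_, fun x hx => ?_⟩
  · have := hN hx
    rw [hQ a ha] at this
    filter_upwards [hev, eventually_lt_nhds this] with s hs hsx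
    rwa [← hN.lt_iff_gt, hQ s hs]
  · have := hN hx
    rw [hQ a ha] at this
    filter_upwards [hev, eventually_gt_nhds this] with s hs hsx
    rwa [← hN.lt_iff_gt, hQ s hs]

theorem hasDerivAt_of_forall_sub_le {G Q : ℝ → ℝ} {U : Set ℝ} {a : ℝ} (hU : U ∈ 𝓝 a)
    (hQ : ContinuousAt Q a)
    (h : ∀ s ∈ U, ∀ t ∈ U, G t - G s ≤ Q s * (t - s)) : HasDerivAt G (Q a) a := by
  rw [hasDerivAt_iff_isLittleO, Asymptotics.isLittleO_iff]
  intro ε hε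
  filter_upwards [hU, Metric.continuousAt_iff'.1 hQ ε hε] with s hs hsε
  have h1 := h a (mem_of_mem_nhds hU) s hs
  have h2 := h s hs a (mem_of_mem_nhds hU)
  rw [Real.dist_eq] at hsε
  have h3 : |G s - G a - (s - a) • Q a| ≤ |(Q s - Q a) * (s - a)| := by
    rw [smul_eq_mul, abs_of_nonpos (by linarith)]
    exact (show _ ≤ -((Q s - Q a) * (s - a)) by linarith).trans (neg_le_abs _)
  rw [abs_mul] at h3
  simp only [Real.norm_eq_abs]
  exact h3.trans (by gcongr)

theorem integral_mul_eq_zero_of_even (heven : ∀ x, p (-x) = p x) : ∫ x, x * p x = 0 := by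
  have h := integral_neg_eq_self (fun x => x * p x) volume
  simp only [heven, neg_mul, integral_neg] at h
  linarith

theorem upperMoment_split_le (hpos : ∀ x, 0 < p x) (heven : ∀ x, p (-x) = p x)
    (hi : Integrable p) (hi1 : Integrable fun x => x * p x) (hint : ∫ x, p x = 1)
    (hlc : ∀ x y θ : ℝ, 0 ≤ θ → θ ≤ 1 → p x ^ θ * p y ^ (1 - θ) ≤ p (θ * x + (1 - θ) * y))
    {Q : ℝ → ℝ} (hQ : ∀ a ∈ Ioo (0 : ℝ) 1, ∫ x in Ioi (Q a), p x = a)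
    (hhalf : ∫ x in Ioi 0, p x = 1 / 2)
    {a b : ℝ} (hb : 0 < b) (hba : b ≤ a) (ha : a ≤ 1 / 2) (hab : a + b < 1) :
    (∫ x in Ioi (Q a), x * p x) ^ 2 / a + (∫ x in Ioi (Q b), x * p x) ^ 2 / b +
        ((∫ x in Ioi (Q a), x * p x) - ∫ x in Ioi (Q b), x * p x) ^ 2 / (1 - a - b) ≤
      2 * ((∫ x in Ioi (Q ((a + b) / 2)), x * p x) ^ 2 / ((a + b) / 2)) := by
  have hN := upperMass_strictAnti hpos hi
  have hQanti : ∀ a b, 0 < b → b ≤ a → a ≤ 1 / 2 → Q a ≤ Q b := fun a b hb hba ha => by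
    rw [← hN.le_iff_ge]
    rwa [hQ a ⟨by linarith, by linarith⟩, hQ b ⟨by linarith, by linarith⟩]
  refine split_le (G := fun a => ∫ x in Ioi (Q a), x * p x) (Q := Q) ?_ ?_ ?_ ?_ ?_ hb hba ha hab
  · intro a ha
    refine hasDerivAt_of_forall_sub_le (Ioo_mem_nhds ha.1 ha.2)
      (quantile_continuousAt hN hQ ha) fun s hs t ht => ?_
    have h := setIntegral_sub_mul_le_Ioi hpos hi hi1 (S := Ioi (Q t)) measurableSet_Ioi (Q s)
    rw [setIntegral_sub_mul hi hi1, setIntegral_sub_mul hi hi1, hQ s hs, hQ t ht] at h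
    linarith
  · intro a ha
    rw [← hN.le_iff_ge]
    rw [hQ a ⟨ha.1, by linarith [ha.2]⟩, hhalf]
    exact ha.2
  · intro a b hb hba ha
    have h := mean_residual_antitone hpos hi hi1 hlc (hQanti a b hb hba ha)
    rwa [hQ a ⟨by linarith, by linarith⟩, hQ b ⟨by linarith, by linarith⟩] at h
  · intro a ha
    have h := setIntegral_sub_mul_le_Ioi hpos hi hi1 (S := ∅) MeasurableSet.empty (Q a)
    rw [setIntegral_sub_mul hi hi1 (Ioi _), hQ a ha, setIntegral_empty] at h
    rw [sub_nonneg, le_div_iff₀ ha.1]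
    linarith
  · intro a b hb hba ha hab
    have hQ0 : 0 ≤ Q a := by
      rw [← hN.le_iff_ge]
      rwa [hQ a ⟨by linarith, by linarith⟩, hhalf]
    have hle := hQanti a b hb hba ha
    have h := midpoint_le hpos heven hi hi1 hlc hle
    have e0 := integral_Iio_add_Icc_add_Ioi hi (show -Q b ≤ Q a by linarith)
    have e1 := integral_Iio_add_Icc_add_Ioi hi1 (show -Q b ≤ Q a by linarith)
    rw [integral_Iio_neg_of_even heven, hQ a ⟨by linarith, by linarith⟩,
      hQ b ⟨by linarith, by linarith⟩, hint] at e0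
    rw [integral_Iio_neg_mul_of_even heven, integral_mul_eq_zero_of_even heven] at e1
    rw [setIntegral_sub_mul hi hi1, show ∫ x in Icc (-Q b) (Q a), p x = 1 - a - b by linarith,
      show ∫ x in Icc (-Q b) (Q a), x * p x =
        (∫ x in Ioi (Q b), x * p x) - ∫ x in Ioi (Q a), x * p x by linarith] at h
    rw [le_div_iff₀ (by linarith)]
    linarith

theorem setIntegral_mul_le_upperMoment (hpos : ∀ x, 0 < p x) (hi : Integrable p)
    (hi1 : Integrable fun x => x * p x) {S : Set ℝ} (hS : MeasurableSet S) {c : ℝ}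
    (hc : ∫ x in Ioi c, p x = ∫ x in S, p x) :
    ∫ x in S, x * p x ≤ ∫ x in Ioi c, x * p x := by
  have h := setIntegral_sub_mul_le_Ioi hpos hi hi1 hS c
  rw [setIntegral_sub_mul hi hi1, setIntegral_sub_mul hi hi1, hc] at h
  linarith

theorem setIntegral_preimage_neg (f : ℝ → ℝ) (S : Set ℝ) :
    ∫ x in Neg.neg ⁻¹' S, f (-x) = ∫ x in S, f x :=
  (Measure.measurePreserving_neg volume).setIntegral_preimage_emb
    (MeasurableEquiv.neg ℝ).measurableEmbedding f S

theorem neg_setIntegral_mul_le_upperMoment (hpos : ∀ x, 0 < p x) (heven : ∀ x, p (-x) = p x)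
    (hi : Integrable p) (hi1 : Integrable fun x => x * p x) {S : Set ℝ} (hS : MeasurableSet S)
    {c : ℝ} (hc : ∫ x in Ioi c, p x = ∫ x in S, p x) :
    -∫ x in S, x * p x ≤ ∫ x in Ioi c, x * p x := by
  have h0 := setIntegral_preimage_neg p S
  have h1 := setIntegral_preimage_neg (fun x => x * p x) S
  simp only [heven, neg_mul, integral_neg] at h0 h1
  rw [← h1, neg_neg]
  exact setIntegral_mul_le_upperMoment hpos hi hi1 (measurable_neg hS) (hc.trans h0.symm)

theorem setIntegral_add_add_of_partition {f : ℝ → ℝ} (hf : Integrable f) {A B C : Set ℝ}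
    (hB : MeasurableSet B) (hC : MeasurableSet C) (hAB : Disjoint A B) (hAC : Disjoint A C)
    (hBC : Disjoint B C) (hunion : A ∪ B ∪ C = univ) :
    (∫ x in A, f x) + (∫ x in B, f x) + (∫ x in C, f x) = ∫ x, f x := by
  rw [← setIntegral_union hAB hB hf.integrableOn hf.integrableOn,
    ← setIntegral_union (hAC.union_left hBC) hC hf.integrableOn hf.integrableOn, hunion,
    setIntegral_univ]

theorem sq_div_mul_self {A B C : ℝ} (hB : 0 < B) : (A / B - (C / B) ^ 2) * B = A - C ^ 2 / B := by
  field_simp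

end

/-- Proposition 1: a symmetric threshold partition with the same
non-transmission probability has no larger three-level quantizer distortion. -/
theorem stmt4
    (p : ℝ → ℝ)
    (hmeas : Measurable p)
    (hnonneg : ∀ x, 0 ≤ p x)
    (hint : (∫ x, p x) = 1)
    (heven : ∀ x, p (-x) = p x)
    (hpos : ∀ x, 0 < p x)
    (hlogconcave : ∀ x y θ : ℝ, 0 ≤ θ → θ ≤ 1 →
      p x ^ θ * p y ^ (1 - θ) ≤ p (θ * x + (1 - θ) * y))
    (hC1 : ContDiffOn ℝ 1 p (Ioi 0))
    (hmom2 : Integrable (fun x => x ^ 2 * p x))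
    (P : Set ℝ → ℝ) (hP : ∀ S, P S = ∫ x in S, p x)
    (m : Set ℝ → ℝ) (hm : ∀ S, m S = (∫ x in S, x * p x) / P S)
    (Var : Set ℝ → ℝ)
    (hVar : ∀ S, Var S = (∫ x in S, x ^ 2 * p x) / P S - m S ^ 2)
    (T0 Tp Tm : Set ℝ)
    (hT0meas : MeasurableSet T0) (hTpmeas : MeasurableSet Tp)
    (hTmmeas : MeasurableSet Tm)
    (hTpsub : Tp ⊆ Ioi 0) (hTmsub : Tm ⊆ Iio 0)
    (hd0p : Disjoint T0 Tp) (hd0m : Disjoint T0 Tm) (hdpm : Disjoint Tp Tm)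
    (hunion : T0 ∪ Tp ∪ Tm = univ)
    (hP0 : 0 < P T0) (hPp : 0 < P Tp) (hPm : 0 < P Tm)
    (horder1 : m Tm < m T0) (horder2 : m T0 < m Tp) :
    ∃ β : ℝ, 0 < β ∧
      P (Ioo (-β) β) = P T0 ∧
      Var (Ioo (-β) β) * P (Ioo (-β) β) + Var (Ioi β) * P (Ioi β) +
          Var (Iio (-β)) * P (Iio (-β)) ≤
        Var T0 * P T0 + Var Tp * P Tp + Var Tm * P Tm := by
  have hi : Integrable p := by
    by_contra h
    rw [integral_undef h] at hint
    exact zero_ne_one hint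
  have hi1 : Integrable fun x => x * p x := by
    refine (hi.add hmom2).mono' (measurable_id.mul hmeas).aestronglyMeasurable
      (.of_forall fun x => ?_)
    have := hnonneg x
    simp only [Pi.add_apply, Real.norm_eq_abs, abs_mul, abs_of_nonneg this]
    nlinarith [sq_abs x, sq_nonneg (|x| - 1), abs_nonneg x,
      mul_nonneg (sq_nonneg (|x| - 1)) this, mul_nonneg (abs_nonneg x) this]
  have hhalf : ∫ x in Ioi 0, p x = 1 / 2 := by
    have h := integral_Iio_add_Icc_add_Ioi hi (le_refl (0 : ℝ))
    have h2 := integral_Iio_neg_of_even heven 0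
    rw [neg_zero] at h2
    rw [h2, hint, Icc_self, integral_singleton] at h
    simp only [measureReal_def, Real.volume_singleton, ENNReal.toReal_zero, zero_smul] at h
    linarith
  have hhalf' : ∫ x in Iio 0, p x = 1 / 2 := by
    rw [← hhalf, ← integral_Iio_neg_of_even heven 0, neg_zero]
  have hmass := setIntegral_add_add_of_partition hi hTpmeas hTmmeas hd0p hd0m hdpm hunion
  have hmom := setIntegral_add_add_of_partition hi1 hTpmeas hTmmeas hd0p hd0m hdpm hunion
  have hsq := setIntegral_add_add_of_partition hmom2 hTpmeas hTmmeas hd0p hd0m hdpm hunion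
  rw [integral_mul_eq_zero_of_even heven] at hmom
  rw [hint] at hmass
  have hp_le : P Tp ≤ 1 / 2 := by
    rw [hP, ← hhalf]
    exact setIntegral_mono_set hi.integrableOn (.of_forall hnonneg) hTpsub.eventuallyLE
  have hm_le : P Tm ≤ 1 / 2 := by
    rw [hP, ← hhalf']
    exact setIntegral_mono_set hi.integrableOn (.of_forall hnonneg) hTmsub.eventuallyLE
  rw [← hP, ← hP, ← hP] at hmass
  choose! Q hQ using fun a (ha : a ∈ Ioo (0 : ℝ) 1) => exists_upper_quantile hi hint ha
  have hU := setIntegral_mul_le_upperMoment hpos hi hi1 hTpmeas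
    (c := Q (P Tp)) ((hQ _ ⟨hPp, by linarith⟩).trans (hP Tp))
  have hV := neg_setIntegral_mul_le_upperMoment hpos heven hi hi1 hTmmeas
    (c := Q (P Tm)) ((hQ _ ⟨hPm, by linarith⟩).trans (hP Tm))
  have hF := sq_div_add_le hPp hPm hP0 hU hV
    (by rw [hm, hm] at horder1
        rw [neg_neg, show -(∫ x in Tm, x * p x) - ∫ x in Tp, x * p x = ∫ x in T0, x * p x by
          linarith]
        exact horder1.le)
    (by rw [hm, hm] at horder2
        rw [show -(∫ x in Tm, x * p x) - ∫ x in Tp, x * p x = ∫ x in T0, x * p x by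
          linarith]
        exact horder2.le)
  have hsplit : (∫ x in Ioi (Q (P Tp)), x * p x) ^ 2 / P Tp +
        (∫ x in Ioi (Q (P Tm)), x * p x) ^ 2 / P Tm +
        ((∫ x in Ioi (Q (P Tp)), x * p x) - ∫ x in Ioi (Q (P Tm)), x * p x) ^ 2 / P T0 ≤
      2 * ((∫ x in Ioi (Q ((P Tp + P Tm) / 2)), x * p x) ^ 2 / ((P Tp + P Tm) / 2)) := by
    rcases le_total (P Tm) (P Tp) with h | h
    · have := upperMoment_split_le hpos heven hi hi1 hint hlogconcave hQ hhalf hPm h hp_le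
        (by linarith)
      rwa [show 1 - P Tp - P Tm = P T0 by linarith] at this
    · have := upperMoment_split_le hpos heven hi hi1 hint hlogconcave hQ hhalf hPp h hm_le
        (by linarith)
      rw [show 1 - P Tm - P Tp = P T0 by linarith, add_comm (P Tm), sub_sq_comm] at this
      linarith
  set q := (P Tp + P Tm) / 2 with hq
  have hq0 : 0 < q := by linarith
  have hNq := hQ q ⟨hq0, by linarith⟩
  have hβ : 0 < Q q := by
    rw [← (upperMass_strictAnti hpos hi).lt_iff_gt]
    rw [hNq, hhalf]
    linarith
  have e0 := integral_Iio_add_Icc_add_Ioi hi (show -Q q ≤ Q q by linarith)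
  have e1 := integral_Iio_add_Icc_add_Ioi hi1 (show -Q q ≤ Q q by linarith)
  have e2 := integral_Iio_add_Icc_add_Ioi hmom2 (show -Q q ≤ Q q by linarith)
  rw [integral_Icc_eq_integral_Ioo] at e0 e1 e2
  rw [integral_Iio_neg_of_even heven, hint] at e0
  rw [integral_Iio_neg_mul_of_even heven, integral_mul_eq_zero_of_even heven] at e1
  have f1 : P (Ioi (Q q)) = q := (hP _).trans hNq
  have f2 : P (Iio (-Q q)) = q := by rw [hP, integral_Iio_neg_of_even heven, hNq]
  have f0 : P (Ioo (-Q q) (Q q)) = P T0 := by rw [hP]; linarith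
  refine ⟨Q q, hβ, f0, ?_⟩
  simp only [hVar, hm, f0, f1, f2, sq_div_mul_self hPp, sq_div_mul_self hPm, sq_div_mul_self hP0,
    sq_div_mul_self hq0]
  rw [integral_Iio_neg_mul_of_even heven, show ∫ x in Ioo (-Q q) (Q q), x * p x = 0 by linarith,
    show ∫ x in T0, x * p x = -((∫ x in Tp, x * p x) - -∫ x in Tm, x * p x) by linarith]
  simp only [neg_sq, ne_eq, OfNat.ofNat_ne_zero, not_false_eq_true, zero_pow, zero_div] at hF ⊢
  linarith
end

section
/- Let A = [−τ,τ] with τ > 0 be a symmetric closed interval with ∫_A p > 0, and let B ⊆ ℝ be any measurable set with ∫_B p = ∫_A p. Then Var(A) ≤ Var(B), i.e., the conditional variance of X given X ∈ A is no larger than the conditional variance of X given X ∈ B. (Lemma 5.) -/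
open MeasureTheory Set

/-- An even log-concave function is antitone in the absolute value of its argument. -/
theorem even_logConcave_le_of_abs_le {p : ℝ → ℝ} (hnonneg : ∀ x, 0 ≤ p x)
    (heven : ∀ x, p (-x) = p x)
    (hlogconcave : ∀ x y θ : ℝ, 0 ≤ θ → θ ≤ 1 →
      p x ^ θ * p y ^ (1 - θ) ≤ p (θ * x + (1 - θ) * y))
    {x y : ℝ} (hxy : |x| ≤ |y|) : p y ≤ p x := by
  wlog hy : 0 ≤ y generalizing y
  · rw [← heven y]
    exact this (by rwa [abs_neg]) (by linarith)
  rw [abs_of_nonneg hy, abs_le] at hxy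
  rcases hy.eq_or_lt with rfl | hy
  · rw [show x = 0 by linarith [hxy.1, hxy.2]]
  have h := hlogconcave y (-y) ((x + y) / (2 * y)) (div_nonneg (by linarith) (by linarith))
    (by rw [div_le_one (by linarith)]; linarith)
  rw [heven, ← Real.rpow_add' (hnonneg y) (by simp)] at h
  have hx : (x + y) / (2 * y) * y + (1 - (x + y) / (2 * y)) * -y = x := by
    field_simp
    ring
  simpa only [hx, add_sub_cancel, Real.rpow_one] using h

/-- Among intervals of a fixed length, the centred one has the largest mass under a density that is
antitone in the absolute value. -/
theorem setIntegral_Icc_shift_le {p : ℝ → ℝ} (hp : Integrable p)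
    (hanti : ∀ x y, |x| ≤ |y| → p y ≤ p x) (a : ℝ) {r : ℝ} (hr : 0 ≤ r) :
    ∫ x in Icc (a - r) (a + r), p x ≤ ∫ x in Icc (-r) r, p x := by
  have heven : ∀ x, p (-x) = p x := fun x =>
    le_antisymm (hanti _ _ (by simp)) (hanti _ _ (by simp))
  rw [integral_Icc_eq_integral_Ioc, integral_Icc_eq_integral_Ioc,
    ← intervalIntegral.integral_of_le (by linarith),
    ← intervalIntegral.integral_of_le (by linarith)]
  wlog ha : 0 ≤ a generalizing a
  · have h := this (-a) (by linarith)
    have h2 := intervalIntegral.integral_comp_neg (a := a - r) (b := a + r) p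
    simp only [heven] at h2
    rw [h2]
    convert h using 2 <;> ring
  have hi : ∀ u v, IntervalIntegrable p volume u v := fun u v => hp.intervalIntegrable
  have h1 := intervalIntegral.integral_add_adjacent_intervals (hi (-r) (a - r)) (hi (a - r) (a + r))
  have h2 := intervalIntegral.integral_add_adjacent_intervals (hi (-r) r) (hi r (a + r))
  have h3 : ∫ x in r..(a + r), p x ≤ ∫ x in (-r)..(a - r), p x := by
    have e1 := intervalIntegral.integral_comp_add_right (a := 0) (b := a) p r
    have e2 := intervalIntegral.integral_comp_sub_right (a := 0) (b := a) p r
    rw [zero_add] at e1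
    rw [zero_sub] at e2
    rw [← e1, ← e2]
    refine intervalIntegral.integral_mono_on ha (hp.comp_add_right r).intervalIntegrable
      (hp.comp_sub_right r).intervalIntegrable fun x hx => hanti _ _ ?_
    rw [abs_of_nonneg (by linarith [hx.1] : 0 ≤ x + r), abs_le]
    constructor <;> linarith [hx.1]
  linarith

/-- If centred intervals are the heaviest of their length, then the second moment about zero on a
centred interval is at most the second moment about any point on a set of the same mass. -/
theorem lintegral_sq_Icc_le_of_measure_eq {ν : Measure ℝ} [IsFiniteMeasure ν] {a τ : ℝ}
    (hν : ∀ r, 0 ≤ r → ν (Icc (a - r) (a + r)) ≤ ν (Icc (-r) r))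
    {B : Set ℝ} (hB : ν B = ν (Icc (-τ) τ)) :
    ∫⁻ x in Icc (-τ) τ, ENNReal.ofReal (x ^ 2) ∂ν ≤
      ∫⁻ x in B, ENNReal.ofReal ((x - a) ^ 2) ∂ν := by
  rw [lintegral_eq_lintegral_meas_lt _ (ae_of_all _ fun x => sq_nonneg x)
      (by fun_prop),
    lintegral_eq_lintegral_meas_lt _ (ae_of_all _ fun x => sq_nonneg (x - a))
      (by fun_prop)]
  refine setLIntegral_mono' measurableSet_Ioi fun t ht => ?_
  have ht : 0 < t := ht
  have hr := Real.sqrt_nonneg t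
  have hset : ∀ b : ℝ, {x : ℝ | t < (x - b) ^ 2} = (Icc (b - √t) (b + √t))ᶜ := by
    intro b
    ext x
    rw [mem_ofPred_eq, mem_compl_iff, ← not_le, not_iff_not, Real.sq_le ht.le, mem_Icc]
    constructor <;> rintro ⟨h1, h2⟩ <;> constructor <;> linarith
  have h0 := hset 0
  simp only [sub_zero, zero_sub, zero_add] at h0
  rw [h0, hset a, Measure.restrict_apply measurableSet_Icc.compl,
    Measure.restrict_apply measurableSet_Icc.compl, inter_comm, ← sdiff_eq, inter_comm, ← sdiff_eq]
  rcases le_total τ √t with h | h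
  · rw [sdiff_eq_empty.2 (Icc_subset_Icc (by linarith) h), measure_empty]
    exact zero_le
  · rw [measure_sdiff (Icc_subset_Icc (by linarith) h) measurableSet_Icc.nullMeasurableSet
      (measure_ne_top _ _), ← hB]
    exact (tsub_le_tsub_left (hν _ hr) _).trans le_measure_sdiff

theorem ofReal_setIntegral_mul_density {p g : ℝ → ℝ} (hmeas : Measurable p)
    (hnonneg : ∀ x, 0 ≤ p x) (hg : Measurable g) (hg0 : ∀ x, 0 ≤ g x)
    (hgp : Integrable fun x => g x * p x) {S : Set ℝ} (hS : MeasurableSet S) :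
    ENNReal.ofReal (∫ x in S, g x * p x) =
      ∫⁻ x in S, ENNReal.ofReal (g x) ∂volume.withDensity fun x => ENNReal.ofReal (p x) := by
  rw [ofReal_integral_eq_lintegral_ofReal hgp.integrableOn
      (ae_of_all _ fun x => mul_nonneg (hg0 x) (hnonneg x)),
    restrict_withDensity hS,
    lintegral_withDensity_eq_lintegral_mul _ hmeas.ennreal_ofReal hg.ennreal_ofReal]
  refine lintegral_congr fun x => ?_
  rw [Pi.mul_apply, mul_comm, ENNReal.ofReal_mul (hnonneg x)]

/-- For a density that is antitone in the absolute value, the second moment about zero on a centred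
interval is at most the second moment about any point on a set of the same mass. -/
theorem setIntegral_sq_mul_Icc_le {p : ℝ → ℝ} (hmeas : Measurable p) (hnonneg : ∀ x, 0 ≤ p x)
    (hp : Integrable p) (hanti : ∀ x y, |x| ≤ |y| → p y ≤ p x) {a τ : ℝ}
    (h2 : Integrable fun x => x ^ 2 * p x) (h2a : Integrable fun x => (x - a) ^ 2 * p x)
    {B : Set ℝ} (hB : MeasurableSet B) (hmass : ∫ x in B, p x = ∫ x in Icc (-τ) τ, p x) :
    ∫ x in Icc (-τ) τ, x ^ 2 * p x ≤ ∫ x in B, (x - a) ^ 2 * p x := by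
  set ν := volume.withDensity fun x => ENNReal.ofReal (p x) with hν
  have : IsFiniteMeasure ν := isFiniteMeasure_withDensity_ofReal hp.2
  have hνS : ∀ S, MeasurableSet S → ν S = ENNReal.ofReal (∫ x in S, p x) := fun S hS => by
    rw [hν, withDensity_apply _ hS,
      ofReal_integral_eq_lintegral_ofReal hp.integrableOn (ae_of_all _ hnonneg)]
  have key : ∫⁻ x in Icc (-τ) τ, ENNReal.ofReal (x ^ 2) ∂ν ≤
      ∫⁻ x in B, ENNReal.ofReal ((x - a) ^ 2) ∂ν := by
    refine lintegral_sq_Icc_le_of_measure_eq (fun r hr => ?_) ?_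
    · rw [hνS _ measurableSet_Icc, hνS _ measurableSet_Icc]
      exact ENNReal.ofReal_le_ofReal (setIntegral_Icc_shift_le hp hanti a hr)
    · rw [hνS _ hB, hνS _ measurableSet_Icc, hmass]
  rw [← ofReal_setIntegral_mul_density hmeas hnonneg (by fun_prop) (fun x => sq_nonneg x) h2
      measurableSet_Icc,
    ← ofReal_setIntegral_mul_density hmeas hnonneg (by fun_prop) (fun x => sq_nonneg (x - a)) h2a
      hB] at key
  exact (ENNReal.ofReal_le_ofReal_iff (integral_nonneg fun x =>
    mul_nonneg (sq_nonneg _) (hnonneg x))).1 key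

/-- Lemma 5: the conditional variance given a symmetric interval A is no
larger than the conditional variance given any set B of the same p-mass. -/
theorem stmt6
    (p : ℝ → ℝ)
    (hmeas : Measurable p)
    (hnonneg : ∀ x, 0 ≤ p x)
    (hint : (∫ x, p x) = 1)
    (heven : ∀ x, p (-x) = p x)
    (hlogconcave : ∀ x y θ : ℝ, 0 ≤ θ → θ ≤ 1 →
      p x ^ θ * p y ^ (1 - θ) ≤ p (θ * x + (1 - θ) * y))
    (hmom2 : Integrable (fun x => x ^ 2 * p x))
    (P : Set ℝ → ℝ) (hP : ∀ S, P S = ∫ x in S, p x)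
    (m : Set ℝ → ℝ) (hm : ∀ S, m S = (∫ x in S, x * p x) / P S)
    (Var : Set ℝ → ℝ)
    (hVar : ∀ S, Var S = (∫ x in S, x ^ 2 * p x) / P S - m S ^ 2)
    (τ : ℝ) (hτ : 0 < τ)
    (hA : 0 < P (Icc (-τ) τ))
    (B : Set ℝ) (hB : MeasurableSet B)
    (hmass : P B = P (Icc (-τ) τ)) :
    Var (Icc (-τ) τ) ≤ Var B := by
  have hp : Integrable p := by
    by_contra h
    rw [integral_undef h] at hint
    exact zero_ne_one hint
  have hanti : ∀ x y, |x| ≤ |y| → p y ≤ p x := fun x y h =>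
    even_logConcave_le_of_abs_le hnonneg heven hlogconcave h
  have hmom1 : Integrable fun x => x * p x := by
    refine (hp.add hmom2).mono' (measurable_id.mul hmeas).aestronglyMeasurable
      (ae_of_all _ fun x => ?_)
    rw [Real.norm_eq_abs, abs_mul, abs_of_nonneg (hnonneg x), Pi.add_apply]
    nlinarith [hnonneg x, sq_abs x, mul_nonneg (hnonneg x) (sq_nonneg (|x| - 1)),
      mul_nonneg (hnonneg x) (sq_nonneg x)]
  have hexp : ∀ a : ℝ, (fun x => (x - a) ^ 2 * p x) =
      fun x => x ^ 2 * p x - 2 * a * (x * p x) + a ^ 2 * p x := fun a => by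
    ext x
    ring
  have h2a : ∀ a : ℝ, Integrable fun x => (x - a) ^ 2 * p x := fun a => by
    rw [hexp]
    exact (hmom2.sub (hmom1.const_mul _)).add (hp.const_mul _)
  have hPB : 0 < P B := hmass ▸ hA
  have hsecond : ∫ x in B, (x - m B) ^ 2 * p x = Var B * P B := by
    have hmB : ∫ x in B, x * p x = m B * P B := by
      rw [hm B]
      field_simp
    have hsub : IntegrableOn (fun x => x ^ 2 * p x - 2 * m B * (x * p x)) B :=
      (hmom2.sub (hmom1.const_mul _)).integrableOn
    rw [hexp, integral_add hsub (hp.const_mul _).integrableOn,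
      integral_sub hmom2.integrableOn (hmom1.const_mul _).integrableOn,
      integral_const_mul, integral_const_mul, hmB, ← hP B, hVar B]
    field_simp
    ring
  have key := setIntegral_sq_mul_Icc_le hmeas hnonneg hp hanti hmom2 (h2a (m B)) hB
    (by rw [← hP, ← hP, hmass])
  calc Var (Icc (-τ) τ) ≤ (∫ x in Icc (-τ) τ, x ^ 2 * p x) / P (Icc (-τ) τ) := by
        rw [hVar]
        linarith [sq_nonneg (m (Icc (-τ) τ))]
    _ ≤ Var B := by
        rw [← hmass, div_le_iff₀ hPB, ← hsecond]
        exact key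
end

section
/- Let p be a continuously differentiable, log-concave probability density supported on an open interval (a,b) (with p > 0 on (a,b) and ∫_a^b p = 1), having finite first moment. Then the function G(β) = (∫_β^b x p(x) dx)/(∫_β^b p(x) dx) − β is monotone decreasing in β on (a,b): for all a < β₁ < β₂ < b, G(β₂) ≤ G(β₁). (Lemma 6, the Bagnoli–Bergstrom mean-residual property of log-concave densities.) -/
open MeasureTheory Set

/-- Translates of a log-concave function that vanishes off `I` are totally positive of order two. -/
lemma mul_translate_le_of_logConcave {I : Set ℝ} {p : ℝ → ℝ}
    (hnonneg : ∀ x, 0 ≤ p x) (hposI : ∀ x ∈ I, 0 < p x) (hzero : ∀ x ∉ I, p x = 0)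
    (hlogconcave : ∀ x ∈ I, ∀ y ∈ I, ∀ θ : ℝ, 0 ≤ θ → θ ≤ 1 →
      p x ^ θ * p y ^ (1 - θ) ≤ p (θ * x + (1 - θ) * y))
    {α β s t : ℝ} (hαβ : α < β) (hst : s < t) :
    p (s + α) * p (t + β) ≤ p (t + α) * p (s + β) := by
  have hR : 0 ≤ p (t + α) * p (s + β) := mul_nonneg (hnonneg _) (hnonneg _)
  by_cases hx : s + α ∈ I
  swap
  · simpa [hzero _ hx] using hR
  by_cases hy : t + β ∈ I
  swap
  · simpa [hzero _ hy] using hR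
  have hD : 0 < (β - α) + (t - s) := by linarith
  set θ : ℝ := (β - α) / ((β - α) + (t - s)) with hθ
  have h0 : 0 ≤ θ := div_nonneg (by linarith) hD.le
  have h1 : θ ≤ 1 := (div_le_one hD).2 (by linarith)
  have hθD : θ * ((β - α) + (t - s)) = β - α := div_mul_cancel₀ _ hD.ne'
  have hu := hlogconcave _ hx _ hy θ h0 h1
  have hv := hlogconcave _ hx _ hy (1 - θ) (by linarith) (by linarith)
  have eu : θ * (s + α) + (1 - θ) * (t + β) = t + α := by linear_combination -hθD
  have ev : (1 - θ) * (s + α) + (1 - (1 - θ)) * (t + β) = s + β := by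
    linear_combination hθD
  rw [eu] at hu
  rw [ev] at hv
  have px := hposI _ hx
  have py := hposI _ hy
  have key := mul_le_mul hu hv (by positivity) (hnonneg _)
  have ex : p (s + α) ^ θ * p (s + α) ^ (1 - θ) = p (s + α) := by
    rw [← Real.rpow_add px]; simp
  have ey : p (t + β) ^ (1 - θ) * p (t + β) ^ (1 - (1 - θ)) = p (t + β) := by
    rw [← Real.rpow_add py]; simp
  calc p (s + α) * p (t + β)
      = (p (s + α) ^ θ * p (s + α) ^ (1 - θ)) *
        (p (t + β) ^ (1 - θ) * p (t + β) ^ (1 - (1 - θ))) := by rw [ex, ey]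
    _ = _ := by ring
    _ ≤ _ := key

/-- A monotone likelihood ratio orders the means (in cross-multiplied form). -/
lemma integral_mul_integral_le_of_likelihood_ratio {μ : Measure ℝ} {f g : ℝ → ℝ}
    (hf : Integrable f μ) (hg : Integrable g μ)
    (hxf : Integrable (fun t => t * f t) μ) (hxg : Integrable (fun t => t * g t) μ)
    (h : ∀ s t, s < t → f s * g t ≤ f t * g s) :
    (∫ t, t * g t ∂μ) * (∫ t, f t ∂μ) ≤ (∫ t, t * f t ∂μ) * (∫ t, g t ∂μ) := by
  have lin {u v w z : ℝ → ℝ} (hu : Integrable u μ) (hv : Integrable v μ)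
      (hw : Integrable w μ) (hz : Integrable z μ) :
      ∫ t, (u t - v t - w t + z t) ∂μ
        = (∫ t, u t ∂μ) - (∫ t, v t ∂μ) - (∫ t, w t ∂μ) + ∫ t, z t ∂μ := by
    have huv : Integrable (fun t => u t - v t) μ := hu.sub hv
    have huvw : Integrable (fun t => u t - v t - w t) μ := huv.sub hw
    rw [integral_add huvw hz, integral_sub huv hw, integral_sub hu hv]
  have hpt : ∀ s t, f s * (t * g t) - s * f s * g t - g s * (t * f t) + s * g s * f t ≤ 0 := by
    intro s t
    rcases lt_trichotomy s t with hst | rfl | hst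
    · nlinarith [h s t hst]
    · linarith
    · nlinarith [h t s hst]
  have inner : ∀ s, f s * (∫ t, t * g t ∂μ) - s * f s * (∫ t, g t ∂μ)
      - g s * (∫ t, t * f t ∂μ) + s * g s * (∫ t, f t ∂μ) ≤ 0 := by
    intro s
    have e := integral_nonpos (μ := μ) (hpt s)
    rw [lin (hxg.const_mul _) (hg.const_mul _) (hxf.const_mul _) (hf.const_mul _)] at e
    simpa only [integral_const_mul] using e
  have e := integral_nonpos (μ := μ) inner
  rw [lin (hf.mul_const _) (hxf.mul_const _) (hg.mul_const _) (hxg.mul_const _)] at e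
  simp only [integral_mul_const] at e
  linarith

lemma setIntegral_Ioi_eq_comp_add (q : ℝ → ℝ) (β : ℝ) :
    ∫ x in Ioi β, q x = ∫ t in Ioi 0, q (t + β) := by
  have e := (measurePreserving_add_right volume β).setIntegral_preimage_emb
    (measurableEmbedding_addRight β) q (Ioi β)
  simpa using e.symm

/-- Lemma 6 (Bagnoli–Bergstrom): the mean-residual function of a C¹
log-concave density supported on an open interval (a,b) (possibly unbounded)
is monotone decreasing on (a,b). -/
theorem stmt8
    (a b : EReal) (hab : a < b)
    (I : Set ℝ) (hI : I = {x : ℝ | a < (x : EReal) ∧ (x : EReal) < b})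
    (p : ℝ → ℝ)
    (hmeas : Measurable p)
    (hnonneg : ∀ x, 0 ≤ p x)
    (hposI : ∀ x ∈ I, 0 < p x)
    (hzero : ∀ x ∉ I, p x = 0)
    (hint : (∫ x, p x) = 1)
    (hC1 : ContDiffOn ℝ 1 p I)
    (hlogconcave : ∀ x ∈ I, ∀ y ∈ I, ∀ θ : ℝ, 0 ≤ θ → θ ≤ 1 →
      p x ^ θ * p y ^ (1 - θ) ≤ p (θ * x + (1 - θ) * y))
    (hmom1 : Integrable (fun x => |x| * p x))
    (G : ℝ → ℝ)
    (hG : ∀ β, G β = (∫ x in Ioi β, x * p x) / (∫ x in Ioi β, p x) - β) :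
    ∀ β₁ ∈ I, ∀ β₂ ∈ I, β₁ < β₂ → G β₂ ≤ G β₁ := by
  have hp : Integrable p := by
    by_contra h
    simp [integral_undef h] at hint
  have hxp : Integrable (fun x => x * p x) := by
    refine hmom1.mono' (by fun_prop) (ae_of_all _ fun x => ?_)
    simp [abs_of_nonneg (hnonneg x)]
  have hIopen : IsOpen I := by
    rw [hI]
    exact (isOpen_lt continuous_const continuous_coe_real_ereal).inter
      (isOpen_lt continuous_coe_real_ereal continuous_const)
  have hpβ (β : ℝ) : Integrable (fun t => p (t + β)) := hp.comp_add_right β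
  have hxpβ (β : ℝ) : Integrable (fun t => t * p (t + β)) := by
    refine ((hxp.comp_add_right β).sub ((hpβ β).const_mul β)).congr (ae_of_all _ fun t => ?_)
    simp only [Pi.sub_apply]
    ring
  have hpos : ∀ β ∈ I, 0 < ∫ t in Ioi 0, p (t + β) := by
    intro β hβ
    rw [← setIntegral_Ioi_eq_comp_add, setIntegral_pos_iff_support_of_nonneg_ae
      (ae_of_all _ hnonneg) hp.integrableOn]
    obtain ⟨c, hc, hcI⟩ := (mem_nhdsGE_iff_exists_Ico_subset).1
      (mem_nhdsWithin_of_mem_nhds (hIopen.mem_nhds hβ) : I ∈ nhdsWithin β (Ici β))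
    refine lt_of_lt_of_le ?_ (measure_mono (s := Ioo β c) fun x hx =>
      ⟨(hposI x (hcI ⟨hx.1.le, hx.2⟩)).ne', hx.1⟩)
    simpa using hc
  have hGeq : ∀ β ∈ I, G β = (∫ t in Ioi 0, t * p (t + β)) / ∫ t in Ioi 0, p (t + β) := by
    intro β hβ
    have e : ∫ t in Ioi 0, (t + β) * p (t + β)
        = (∫ t in Ioi 0, t * p (t + β)) + β * ∫ t in Ioi 0, p (t + β) := by
      simp only [add_mul]
      rw [integral_add (hxpβ β).integrableOn ((hpβ β).const_mul β).integrableOn,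
        integral_const_mul]
    rw [hG, setIntegral_Ioi_eq_comp_add (fun x => x * p x), setIntegral_Ioi_eq_comp_add p, e,
      add_div, mul_div_cancel_right₀ _ (hpos β hβ).ne', add_sub_cancel_right]
  intro β₁ h₁ β₂ h₂ hlt
  rw [hGeq _ h₁, hGeq _ h₂, div_le_div_iff₀ (hpos _ h₂) (hpos _ h₁)]
  exact integral_mul_integral_le_of_likelihood_ratio (hpβ β₁).integrableOn
    (hpβ β₂).integrableOn (hxpβ β₁).integrableOn (hxpβ β₂).integrableOn fun s t hst =>
      mul_translate_le_of_logConcave hnonneg hposI hzero hlogconcave hlt hst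
end

section
/- Suppose p majorizes q, i.e., for all t ≥ 0, ∫_{−t}^{t} q^σ(x) dx ≤ ∫_{−t}^{t} p^σ(x) dx. If additionally p is even and log-concave, then ∫_ℝ x² p(x) dx ≤ ∫_ℝ (x−y)² q(x) dx for every y ∈ ℝ; in particular the variance of p is at most the variance of q. (Lemma 3.) -/
open MeasureTheory Set
open scoped Classical

theorem measurable_volume_superlevel (f : ℝ → ℝ) :
    Measurable fun ρ : ℝ => volume {z : ℝ | ρ ≤ f z} :=
  Antitone.measurable fun _ _ h => measure_mono fun _ hz => le_trans h hz

/-- The mass of a nonnegative function on a set, by the layer-cake formula. -/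
theorem setLIntegral_eq_lintegral_superlevel {f : ℝ → ℝ} (hf : Measurable f)
    (h0 : ∀ x, 0 ≤ f x) (A : Set ℝ) :
    ∫⁻ x in A, ENNReal.ofReal (f x) =
      ∫⁻ ρ in Ioi (0 : ℝ), volume ({z : ℝ | ρ ≤ f z} ∩ A) := by
  rw [lintegral_eq_lintegral_meas_le _ (Filter.Eventually.of_forall h0) hf.aemeasurable]
  refine lintegral_congr fun ρ => ?_
  rw [Measure.restrict_apply (measurableSet_le measurable_const hf)]

/-- The part of a symmetric rearrangement lying in `[-t, t]` has measure `min (2 * t) v`. -/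
theorem volume_symm_inter_Icc (v : ENNReal) {t : ℝ} (ht : 0 ≤ t) :
    volume ({x : ℝ | ENNReal.ofReal (2 * |x|) ≤ v} ∩ Icc (-t) t) =
      min (ENNReal.ofReal (2 * t)) v := by
  rcases le_total (ENNReal.ofReal (2 * t)) v with h | h
  · rw [min_eq_left h]
    have : {x : ℝ | ENNReal.ofReal (2 * |x|) ≤ v} ∩ Icc (-t) t = Icc (-t) t := by
      refine inter_eq_right.2 fun x hx => ?_
      refine le_trans (ENNReal.ofReal_le_ofReal ?_) h
      linarith [abs_le.2 hx]
    rw [this, Real.volume_Icc]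
    congr 1; ring
  · rw [min_eq_right h]
    have hv : v ≠ ⊤ := ne_top_of_le_ne_top ENNReal.ofReal_ne_top h
    obtain ⟨s, hs, rfl⟩ : ∃ s : ℝ, 0 ≤ s ∧ v = ENNReal.ofReal (2 * s) :=
      ⟨v.toReal / 2, by positivity, by
        rw [mul_div_cancel₀ _ two_ne_zero, ENNReal.ofReal_toReal hv]⟩
    have hst := (ENNReal.ofReal_le_ofReal_iff (by positivity)).1 h
    have : {x : ℝ | ENNReal.ofReal (2 * |x|) ≤ ENNReal.ofReal (2 * s)} ∩ Icc (-t) t =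
        Icc (-s) s := by
      ext x
      simp only [mem_inter_iff, mem_ofPred_eq,
        ENNReal.ofReal_le_ofReal_iff (by positivity : (0 : ℝ) ≤ 2 * s), mem_Icc, ← abs_le]
      exact ⟨fun h1 => by linarith [h1.1], fun h1 => ⟨by linarith, by linarith⟩⟩
    rw [this, Real.volume_Icc]
    congr 1; ring

theorem lintegral_min_superlevel_ne_top {f : ℝ → ℝ} (hf : Measurable f) (h0 : ∀ x, 0 ≤ f x)
    (hint : Integrable f) (c : ENNReal) :
    ∫⁻ ρ in Ioi (0 : ℝ), min c (volume {z : ℝ | ρ ≤ f z}) ≠ ⊤ := by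
  refine ne_top_of_le_ne_top hint.lintegral_lt_top.ne ?_
  rw [← setLIntegral_univ fun x => ENNReal.ofReal (f x),
    setLIntegral_eq_lintegral_superlevel hf h0]
  exact lintegral_mono fun ρ => by simp

/-- The mass of the symmetric rearrangement of `f` on `[-t, t]`. -/
theorem setIntegral_symm_rearrangement {f fσ : ℝ → ℝ} (hf : Measurable f) (h0 : ∀ x, 0 ≤ f x)
    (hint : Integrable f)
    (hσ : ∀ x, fσ x = ∫ ρ in Ioi (0 : ℝ),
      if ENNReal.ofReal (2 * |x|) ≤ volume {z : ℝ | ρ ≤ f z} then (1 : ℝ) else 0)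
    {t : ℝ} (ht : 0 ≤ t) :
    ∫ x in Icc (-t) t, fσ x =
      (∫⁻ ρ in Ioi (0 : ℝ), min (ENNReal.ofReal (2 * t)) (volume {z : ℝ | ρ ≤ f z})).toReal := by
  have hm := measurable_volume_superlevel f
  have hS : MeasurableSet
      {z : ℝ × ℝ | ENNReal.ofReal (2 * |z.1|) ≤ volume {w : ℝ | z.2 ≤ f w}} :=
    measurableSet_le (by fun_prop) (hm.comp measurable_snd)
  set k : ℝ → ℝ → ENNReal := fun x ρ =>
    if ENNReal.ofReal (2 * |x|) ≤ volume {w : ℝ | ρ ≤ f w} then 1 else 0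
  have hk : Measurable (Function.uncurry k) :=
    Measurable.ite hS measurable_const measurable_const
  have hσ' : ∀ x, fσ x = (∫⁻ ρ in Ioi (0 : ℝ), k x ρ).toReal := by
    intro x
    rw [hσ, integral_eq_lintegral_of_nonneg_ae]
    · congr 1
      refine lintegral_congr fun ρ => ?_
      simp only [k]
      split_ifs <;> simp
    · exact Filter.Eventually.of_forall fun ρ => by dsimp only; split_ifs <;> simp
    · exact (Measurable.ite (measurableSet_le measurable_const hm) measurable_const
        measurable_const).aestronglyMeasurable
  have hswap : ∫⁻ x in Icc (-t) t, ∫⁻ ρ in Ioi (0 : ℝ), k x ρ =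
      ∫⁻ ρ in Ioi (0 : ℝ), min (ENNReal.ofReal (2 * t)) (volume {z : ℝ | ρ ≤ f z}) := by
    rw [lintegral_lintegral_swap hk.aemeasurable]
    refine lintegral_congr fun ρ => ?_
    have hSρ : MeasurableSet {x : ℝ | ENNReal.ofReal (2 * |x|) ≤ volume {w : ℝ | ρ ≤ f w}} :=
      measurableSet_le (by fun_prop) measurable_const
    rw [← volume_symm_inter_Icc _ ht, ← Measure.restrict_apply hSρ, ← lintegral_indicator_one hSρ]
    refine lintegral_congr fun x => ?_
    simp only [k, indicator_apply, mem_ofPred_eq, Pi.one_apply]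
  have hkm : Measurable fun x => ∫⁻ ρ in Ioi (0 : ℝ), k x ρ := hk.lintegral_prod_right'
  simp_rw [hσ']
  rw [integral_toReal hkm.aemeasurable, hswap]
  refine ae_lt_top hkm ?_
  rw [hswap]
  exact lintegral_min_superlevel_ne_top hf h0 hint _

/-- A symmetric function decreasing in `|x|` has at least the mass of its rearrangement on
`[-t, t]`. -/
theorem lintegral_min_superlevel_le_of_unimodal {p : ℝ → ℝ} (hp : Measurable p)
    (h0 : ∀ x, 0 ≤ p x) (hanti : ∀ x y, |x| ≤ |y| → p y ≤ p x) (t : ℝ) :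
    ∫⁻ ρ in Ioi (0 : ℝ), min (ENNReal.ofReal (2 * t)) (volume {z : ℝ | ρ ≤ p z}) ≤
      ∫⁻ x in Icc (-t) t, ENNReal.ofReal (p x) := by
  rw [setLIntegral_eq_lintegral_superlevel hp h0]
  refine lintegral_mono fun ρ => ?_
  by_cases h : ∃ z, ρ ≤ p z ∧ t ≤ |z|
  · obtain ⟨z, hz, htz⟩ := h
    refine (min_le_left _ _).trans ?_
    have : ENNReal.ofReal (2 * t) = volume (Icc (-t) t) := by
      rw [Real.volume_Icc]
      congr 1; ring
    rw [this]
    exact measure_mono fun x hx => ⟨hz.trans (hanti _ _ ((abs_le.2 hx).trans htz)), hx⟩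
  · push Not at h
    exact (min_le_right _ _).trans
      (measure_mono fun z hz => ⟨hz, abs_le.1 (h z hz).le⟩)

/-- Any interval of length `2 * t` carries at most the mass of the rearrangement on `[-t, t]`. -/
theorem setLIntegral_Icc_le_lintegral_min_superlevel {q : ℝ → ℝ} (hq : Measurable q)
    (h0 : ∀ x, 0 ≤ q x) (y t : ℝ) :
    ∫⁻ x in Icc (y - t) (y + t), ENNReal.ofReal (q x) ≤
      ∫⁻ ρ in Ioi (0 : ℝ), min (ENNReal.ofReal (2 * t)) (volume {z : ℝ | ρ ≤ q z}) := by
  rw [setLIntegral_eq_lintegral_superlevel hq h0]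
  refine lintegral_mono fun ρ => le_min ?_ (measure_mono inter_subset_left)
  refine (measure_mono inter_subset_right).trans (le_of_eq ?_)
  rw [Real.volume_Icc]
  congr 1; ring

/-- Comparison of second moments of probability measures from comparison of central intervals. -/
theorem lintegral_sq_le_of_measure_Icc_le {μ ν : Measure ℝ} [IsProbabilityMeasure μ]
    [IsProbabilityMeasure ν] (y : ℝ)
    (h : ∀ t, 0 ≤ t → ν (Icc (y - t) (y + t)) ≤ μ (Icc (-t) t)) :
    ∫⁻ x, ENNReal.ofReal (x ^ 2) ∂μ ≤ ∫⁻ x, ENNReal.ofReal ((x - y) ^ 2) ∂ν := by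
  rw [lintegral_eq_lintegral_meas_lt μ (Filter.Eventually.of_forall fun x => sq_nonneg x)
      (by fun_prop),
    lintegral_eq_lintegral_meas_lt ν (Filter.Eventually.of_forall fun x => sq_nonneg (x - y))
      (by fun_prop)]
  refine setLIntegral_mono' measurableSet_Ioi fun s hs => ?_
  have hs0 : (0 : ℝ) ≤ s := le_of_lt hs
  have e1 : {a : ℝ | s < a ^ 2} = (Icc (-√s) √s)ᶜ := by
    ext a
    rw [mem_compl_iff, mem_Icc, ← abs_le, not_le, mem_ofPred_eq, Real.sqrt_lt hs0 (abs_nonneg a),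
      sq_abs]
  have e2 : {a : ℝ | s < (a - y) ^ 2} = (Icc (y - √s) (y + √s))ᶜ := by
    ext a
    have : a ∈ Icc (y - √s) (y + √s) ↔ |a - y| ≤ √s := by
      rw [abs_le, mem_Icc]
      constructor <;> rintro ⟨_, _⟩ <;> constructor <;> linarith
    rw [mem_compl_iff, this, not_le, mem_ofPred_eq, Real.sqrt_lt hs0 (abs_nonneg _), sq_abs]
  rw [e1, e2, prob_compl_eq_one_sub measurableSet_Icc, prob_compl_eq_one_sub measurableSet_Icc]
  exact tsub_le_tsub_left (h _ (Real.sqrt_nonneg s)) 1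

theorem isProbabilityMeasure_withDensity_ofReal {f : ℝ → ℝ} (h0 : ∀ x, 0 ≤ f x)
    (h : ∫ x, f x = 1) :
    IsProbabilityMeasure (volume.withDensity fun x => ENNReal.ofReal (f x)) := by
  refine ⟨?_⟩
  rw [withDensity_apply _ MeasurableSet.univ, setLIntegral_univ,
    ← ofReal_integral_eq_lintegral_ofReal (integrable_of_integral_eq_one h)
      (Filter.Eventually.of_forall h0), h, ENNReal.ofReal_one]

theorem integral_mul_eq_toReal_lintegral {f g : ℝ → ℝ} (hf : Measurable f)
    (hg : Measurable g)
    (f0 : ∀ x, 0 ≤ f x) (g0 : ∀ x, 0 ≤ g x) :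
    ∫ x, g x * f x = (∫⁻ x, ENNReal.ofReal (g x)
      ∂(volume.withDensity fun x => ENNReal.ofReal (f x))).toReal := by
  rw [integral_eq_lintegral_of_nonneg_ae
      (Filter.Eventually.of_forall fun x => mul_nonneg (g0 x) (f0 x))
      (hg.mul hf).aestronglyMeasurable,
    lintegral_withDensity_eq_lintegral_mul _ hf.ennreal_ofReal hg.ennreal_ofReal]
  congr 1
  refine lintegral_congr fun x => ?_
  rw [Pi.mul_apply, ENNReal.ofReal_mul (g0 x), mul_comm]

/-- Lemma 3: if p is even, log-concave, and majorizes q (in the symmetric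
rearrangement sense), then ∫ x² p ≤ ∫ (x−y)² q for every y. -/
theorem stmt13
    (p q : ℝ → ℝ)
    (hpmeas : Measurable p) (hqmeas : Measurable q)
    (hpnonneg : ∀ x, 0 ≤ p x) (hqnonneg : ∀ x, 0 ≤ q x)
    (hpint : (∫ x, p x) = 1) (hqint : (∫ x, q x) = 1)
    (hpmom2 : Integrable (fun x => x ^ 2 * p x))
    (hqmom2 : Integrable (fun x => x ^ 2 * q x))
    (heven : ∀ x, p (-x) = p x)
    (hlogconcave : ∀ x y θ : ℝ, 0 ≤ θ → θ ≤ 1 →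
      p x ^ θ * p y ^ (1 - θ) ≤ p (θ * x + (1 - θ) * y))
    (pσ qσ : ℝ → ℝ)
    (hpσ : ∀ x, pσ x = ∫ ρ in Ioi (0 : ℝ),
      if ENNReal.ofReal (2 * |x|) ≤ volume {z : ℝ | ρ ≤ p z} then (1 : ℝ) else 0)
    (hqσ : ∀ x, qσ x = ∫ ρ in Ioi (0 : ℝ),
      if ENNReal.ofReal (2 * |x|) ≤ volume {z : ℝ | ρ ≤ q z} then (1 : ℝ) else 0)
    (hmaj : ∀ t : ℝ, 0 ≤ t →
      (∫ x in Icc (-t) t, qσ x) ≤ ∫ x in Icc (-t) t, pσ x) :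
    ∀ y : ℝ, (∫ x, x ^ 2 * p x) ≤ ∫ x, (x - y) ^ 2 * q x := by
  intro y
  have hpi := integrable_of_integral_eq_one hpint
  have hqi := integrable_of_integral_eq_one hqint
  have hanti : ∀ x z, |x| ≤ |z| → p z ≤ p x := by
    intro x z hxz
    rcases eq_or_ne z 0 with rfl | hz
    · rw [abs_zero] at hxz
      rw [abs_eq_zero.1 (le_antisymm hxz (abs_nonneg x))]
    have hr : |x / z| ≤ 1 := by
      rw [abs_div]
      exact div_le_one_of_le₀ hxz (abs_nonneg z)
    obtain ⟨h1, h2⟩ := abs_le.1 hr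
    have h := hlogconcave z (-z) ((1 + x / z) / 2) (by linarith) (by linarith)
    have hx : (1 + x / z) / 2 * z + (1 - (1 + x / z) / 2) * -z = x := by
      field_simp
      ring
    rwa [heven, hx, ← Real.rpow_add_of_nonneg (hpnonneg z) (by linarith) (by linarith),
      add_sub_cancel, Real.rpow_one] at h
  have := isProbabilityMeasure_withDensity_ofReal hpnonneg hpint
  have := isProbabilityMeasure_withDensity_ofReal hqnonneg hqint
  have hq2 : Integrable fun x => (x - y) ^ 2 * q x := by
    refine ((hqmom2.const_mul 2).add (hqi.const_mul (2 * y ^ 2))).mono'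
      (by fun_prop) (Filter.Eventually.of_forall fun x => ?_)
    rw [Real.norm_of_nonneg (mul_nonneg (sq_nonneg _) (hqnonneg x)), Pi.add_apply]
    nlinarith [mul_nonneg (sq_nonneg (x + y)) (hqnonneg x)]
  rw [integral_mul_eq_toReal_lintegral hpmeas (by fun_prop) hpnonneg fun x => sq_nonneg x,
    integral_mul_eq_toReal_lintegral hqmeas (by fun_prop) hqnonneg fun x => sq_nonneg (x - y)]
  refine ENNReal.toReal_mono ?_ (lintegral_sq_le_of_measure_Icc_le y fun t ht => ?_)
  · rw [lintegral_withDensity_eq_lintegral_mul _ hqmeas.ennreal_ofReal (by fun_prop)]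
    refine ne_of_eq_of_ne (lintegral_congr fun x => ?_) hq2.lintegral_lt_top.ne
    rw [Pi.mul_apply, ENNReal.ofReal_mul (sq_nonneg _), mul_comm]
  · rw [withDensity_apply _ measurableSet_Icc, withDensity_apply _ measurableSet_Icc]
    refine (setLIntegral_Icc_le_lintegral_min_superlevel hqmeas hqnonneg y t).trans
      (le_trans ?_ (lintegral_min_superlevel_le_of_unimodal hpmeas hpnonneg hanti t))
    have h := hmaj t ht
    rwa [setIntegral_symm_rearrangement hqmeas hqnonneg hqi hqσ ht,
      setIntegral_symm_rearrangement hpmeas hpnonneg hpi hpσ ht,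
      ENNReal.toReal_le_toReal (lintegral_min_superlevel_ne_top hqmeas hqnonneg hqi _)
        (lintegral_min_superlevel_ne_top hpmeas hpnonneg hpi _)] at h
end

section
/- Assume p is even and log-concave and p majorizes p′. Let A = [−τ,τ] be a symmetric closed interval with ∫_A p > 0, and let h : ℝ → [0,1] be any measurable function with ∫_ℝ h(x) p′(x) dx = ∫_A p(x) dx. Define the conditional density p_A(x) = p(x)/∫_A p for x ∈ A and p_A(x) = 0 otherwise, and the reweighted density r(x) = h(x)p′(x)/∫_ℝ h p′. Then p_A majorizes r. (Lemma 4: majorization is preserved by symmetric-interval conditioning of the dominating density and arbitrary [0,1]-reweighting of the dominated density with matched mass.) -/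
open MeasureTheory Set
open scoped Classical

/-- The mass of the symmetric rearrangement of `f` on `[-t, t]`, by slicing along level sets. -/
noncomputable def rearrangedMass (f : ℝ → ℝ) (t : ℝ) : ENNReal :=
  ∫⁻ ρ in Ioi (0 : ℝ), min (ENNReal.ofReal (2 * t)) (volume {z : ℝ | ρ ≤ f z})

/-- The symmetric rearrangement of `f`. -/
noncomputable def symmRearrangement (f : ℝ → ℝ) (x : ℝ) : ℝ :=
  ∫ ρ in Ioi (0 : ℝ),
    if ENNReal.ofReal (2 * |x|) ≤ volume {z : ℝ | ρ ≤ f z} then (1 : ℝ) else 0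

lemma antitone_volume_superlevel (f : ℝ → ℝ) :
    Antitone fun ρ : ℝ => volume {z : ℝ | ρ ≤ f z} :=
  fun _ _ hab => measure_mono fun _ hz => hab.trans hz

lemma volume_Icc_inter_rearranged_set (t : ℝ) (V : ENNReal) :
    (volume.restrict (Icc (-t) t)) {x : ℝ | ENNReal.ofReal (2 * |x|) ≤ V} =
      min (ENNReal.ofReal (2 * t)) V := by
  have hm : MeasurableSet {x : ℝ | ENNReal.ofReal (2 * |x|) ≤ V} :=
    measurableSet_le (by fun_prop) measurable_const
  rw [Measure.restrict_apply hm]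
  induction V with
  | top => simp [two_mul]
  | coe v =>
    have : {x : ℝ | ENNReal.ofReal (2 * |x|) ≤ (v : ENNReal)} ∩ Icc (-t) t =
        Icc (-(min t (v / 2))) (min t (v / 2)) := by
      ext x
      rw [mem_inter_iff, mem_ofPred_eq, mem_Icc, mem_Icc, ← abs_le, ← abs_le, le_min_iff,
        ← ENNReal.ofReal_coe_nnreal, ENNReal.ofReal_le_ofReal_iff v.coe_nonneg]
      constructor
      · rintro ⟨h1, h2⟩; exact ⟨h2, by linarith⟩
      · rintro ⟨h1, h2⟩; exact ⟨by linarith, h1⟩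
    rw [this, Real.volume_Icc, ← ENNReal.ofReal_coe_nnreal, ← ENNReal.ofReal_min]
    congr 1
    rcases le_total t (v / 2) with h | h
    · rw [min_eq_left h, min_eq_left (by linarith)]; ring
    · rw [min_eq_right h, min_eq_right (by linarith)]; ring

lemma rearrangedMass_le_lintegral {f : ℝ → ℝ} (hf : Measurable f) (h0 : ∀ x, 0 ≤ f x) (t : ℝ) :
    rearrangedMass f t ≤ ∫⁻ x, ENNReal.ofReal (f x) := by
  rw [lintegral_eq_lintegral_meas_le volume (ae_of_all _ h0) hf.aemeasurable]
  exact lintegral_mono fun ρ => min_le_right _ _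

lemma integral_symmRearrangement {f : ℝ → ℝ} (hf : Measurable f) (h0 : ∀ x, 0 ≤ f x)
    (hfi : Integrable f) (t : ℝ) :
    ∫ x in Icc (-t) t, symmRearrangement f x = (rearrangedMass f t).toReal := by
  set S : Set (ℝ × ℝ) := {q | ENNReal.ofReal (2 * |q.1|) ≤ volume {z : ℝ | q.2 ≤ f z}}
  have hSm : MeasurableSet S :=
    measurableSet_le (by fun_prop) ((antitone_volume_superlevel f).measurable.comp measurable_snd)
  have hmass : ((volume.restrict (Icc (-t) t)).prod (volume.restrict (Ioi (0 : ℝ)))) S =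
      rearrangedMass f t := by
    rw [Measure.prod_apply_symm hSm]
    refine lintegral_congr fun ρ => ?_
    rw [← volume_Icc_inter_rearranged_set t]
    rfl
  have hfin : rearrangedMass f t ≠ ⊤ :=
    ((rearrangedMass_le_lintegral hf h0 t).trans_lt hfi.lintegral_lt_top).ne
  have hint : Integrable (S.indicator fun _ => (1 : ℝ))
      ((volume.restrict (Icc (-t) t)).prod (volume.restrict (Ioi (0 : ℝ)))) :=
    (integrable_indicator_iff hSm).2 (integrableOn_const (by rw [hmass]; exact hfin))
  have key := integral_prod _ hint
  rw [integral_indicator hSm, setIntegral_const, Measure.real, hmass] at key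
  simp only [smul_eq_mul, mul_one] at key
  rw [key]
  refine integral_congr_ae (ae_of_all _ fun x => integral_congr_ae (ae_of_all _ fun ρ => ?_))
  simp [S, indicator_apply]

lemma symmRearrangement_div (f : ℝ → ℝ) {c : ℝ} (hc : 0 < c) (x : ℝ) :
    symmRearrangement (fun z => f z / c) x = c⁻¹ * symmRearrangement f x := by
  have := integral_comp_mul_left_Ioi
    (fun ρ => if ENNReal.ofReal (2 * |x|) ≤ volume {z : ℝ | ρ ≤ f z} then (1 : ℝ) else 0) 0 hc
  rw [mul_zero, smul_eq_mul] at this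
  unfold symmRearrangement
  rw [← this]
  simp only [le_div_iff₀ hc, mul_comm c]

/-- An even log-concave function is nonincreasing in `|x|`. -/
lemma le_of_abs_le_of_even_of_logConcave {p : ℝ → ℝ} (hp : ∀ x, 0 ≤ p x)
    (heven : ∀ x, p (-x) = p x)
    (hlc : ∀ x y θ : ℝ, 0 ≤ θ → θ ≤ 1 →
      p x ^ θ * p y ^ (1 - θ) ≤ p (θ * x + (1 - θ) * y))
    {x y : ℝ} (hxy : |x| ≤ |y|) : p y ≤ p x := by
  rcases (hp y).eq_or_lt with h0 | hpos
  · rw [← h0]; exact hp x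
  rcases eq_or_ne y 0 with rfl | hy
  · rw [abs_zero, abs_nonpos_iff] at hxy; rw [hxy]
  have hr : |x / y| ≤ 1 := by
    rw [abs_div]; exact (div_le_one (abs_pos.2 hy)).2 hxy
  obtain ⟨h1, h2⟩ := abs_le.1 hr
  have := hlc y (-y) ((1 + x / y) / 2) (by linarith) (by linarith)
  rw [heven, ← Real.rpow_add hpos, add_sub_cancel, Real.rpow_one] at this
  convert this using 2
  field_simp
  ring

/-- Superlevel sets of a function nonincreasing in `|x|` are symmetric intervals up to endpoints. -/
lemma min_volume_superlevel_le {p : ℝ → ℝ} (hp : ∀ x y : ℝ, |x| ≤ |y| → p y ≤ p x)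
    (t ρ : ℝ) :
    min (ENNReal.ofReal (2 * t)) (volume {z : ℝ | ρ ≤ p z}) ≤
      volume ({z : ℝ | ρ ≤ p z} ∩ Icc (-t) t) := by
  by_cases h : Icc (-t) t ⊆ {z : ℝ | ρ ≤ p z}
  · refine (min_le_left _ _).trans ?_
    rw [inter_eq_right.2 h, Real.volume_Icc, sub_neg_eq_add, two_mul]
  · obtain ⟨y, hy, hyp⟩ := not_subset.1 h
    refine (min_le_right _ _).trans (measure_mono fun z hz => ⟨hz, ?_⟩)
    rw [mem_Icc, ← abs_le] at hy ⊢
    by_contra! hzt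
    exact hyp (le_trans hz (hp _ _ (hy.trans hzt.le)))

lemma rearrangedMass_mono {f g : ℝ → ℝ} (hfg : ∀ x, f x ≤ g x) (t : ℝ) :
    rearrangedMass f t ≤ rearrangedMass g t :=
  lintegral_mono fun _ => min_le_min_left _ (measure_mono fun z hz => le_trans hz (hfg z))

lemma rearrangedMass_le_indicator {p : ℝ → ℝ} (hp : ∀ x y : ℝ, |x| ≤ |y| → p y ≤ p x)
    {t τ : ℝ} (htτ : t ≤ τ) :
    rearrangedMass p t ≤ rearrangedMass ((Icc (-τ) τ).indicator p) t := by
  refine lintegral_mono fun ρ => (min_volume_superlevel_le hp t ρ).trans (le_min ?_ ?_)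
  · refine (measure_mono inter_subset_right).trans ?_
    rw [Real.volume_Icc, sub_neg_eq_add, two_mul]
  · refine measure_mono fun z hz => ?_
    rw [mem_ofPred_eq, indicator_of_mem (Icc_subset_Icc (neg_le_neg htτ) htτ hz.2)]
    exact hz.1

lemma rearrangedMass_indicator_of_le {p : ℝ → ℝ} (hpm : Measurable p) (hp : ∀ x, 0 ≤ p x)
    {t τ : ℝ} (htτ : τ ≤ t) :
    rearrangedMass ((Icc (-τ) τ).indicator p) t =
      ∫⁻ x, ENNReal.ofReal ((Icc (-τ) τ).indicator p x) := by
  rw [lintegral_eq_lintegral_meas_le volume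
    (ae_of_all _ fun x => indicator_nonneg (fun x _ => hp x) x)
    (hpm.indicator measurableSet_Icc).aemeasurable]
  refine setLIntegral_congr_fun measurableSet_Ioi fun ρ hρ => min_eq_right ?_
  calc volume {z : ℝ | ρ ≤ (Icc (-τ) τ).indicator p z} ≤ volume (Icc (-τ) τ) := by
        refine measure_mono fun z hz => ?_
        by_contra hz'
        rw [mem_ofPred_eq, indicator_of_notMem hz'] at hz
        exact absurd hρ (not_lt.2 hz)
    _ ≤ ENNReal.ofReal (2 * t) := by
        rw [Real.volume_Icc]
        exact ENNReal.ofReal_le_ofReal (by linarith)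

/-- Lemma 4: majorization is preserved by symmetric-interval conditioning of
the dominating density and arbitrary [0,1]-reweighting of the dominated
density with matched mass. -/
theorem stmt14
    (p p' : ℝ → ℝ)
    (hpmeas : Measurable p) (hp'meas : Measurable p')
    (hpnonneg : ∀ x, 0 ≤ p x) (hp'nonneg : ∀ x, 0 ≤ p' x)
    (hpint : (∫ x, p x) = 1) (hp'int : (∫ x, p' x) = 1)
    (heven : ∀ x, p (-x) = p x)
    (hlogconcave : ∀ x y θ : ℝ, 0 ≤ θ → θ ≤ 1 →
      p x ^ θ * p y ^ (1 - θ) ≤ p (θ * x + (1 - θ) * y))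
    (σ : (ℝ → ℝ) → ℝ → ℝ)
    (hσ : ∀ f x, σ f x = ∫ ρ in Ioi (0 : ℝ),
      if ENNReal.ofReal (2 * |x|) ≤ volume {z : ℝ | ρ ≤ f z} then (1 : ℝ) else 0)
    (hmaj : ∀ t : ℝ, 0 ≤ t →
      (∫ x in Icc (-t) t, σ p' x) ≤ ∫ x in Icc (-t) t, σ p x)
    (τ : ℝ) (hτ : 0 < τ)
    (hA : 0 < ∫ x in Icc (-τ) τ, p x)
    (h : ℝ → ℝ) (hhmeas : Measurable h)
    (hh0 : ∀ x, 0 ≤ h x) (hh1 : ∀ x, h x ≤ 1)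
    (hhmass : (∫ x, h x * p' x) = ∫ x in Icc (-τ) τ, p x)
    (pA r : ℝ → ℝ)
    (hpA : ∀ x, pA x =
      if x ∈ Icc (-τ) τ then p x / (∫ y in Icc (-τ) τ, p y) else 0)
    (hr : ∀ x, r x = h x * p' x / (∫ y, h y * p' y)) :
    ∀ t : ℝ, 0 ≤ t →
      (∫ x in Icc (-t) t, σ r x) ≤ ∫ x in Icc (-t) t, σ pA x := by
  have hσ' : ∀ f, σ f = symmRearrangement f := fun f => funext (hσ f)
  simp only [hσ'] at hmaj ⊢
  have hanti : ∀ x y : ℝ, |x| ≤ |y| → p y ≤ p x := fun x y hxy =>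
    le_of_abs_le_of_even_of_logConcave hpnonneg heven hlogconcave hxy
  have hpi : Integrable p := .of_integral_ne_zero (by rw [hpint]; exact one_ne_zero)
  have hp'i : Integrable p' := .of_integral_ne_zero (by rw [hp'int]; exact one_ne_zero)
  set g : ℝ → ℝ := fun x => h x * p' x
  set q : ℝ → ℝ := (Icc (-τ) τ).indicator p
  have hgi : Integrable g := .of_integral_ne_zero (by rw [hhmass]; exact hA.ne')
  have hqi : Integrable q := hpi.indicator measurableSet_Icc
  have hg0 : ∀ x, 0 ≤ g x := fun x => mul_nonneg (hh0 x) (hp'nonneg x)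
  have hq0 : ∀ x, 0 ≤ q x := fun x => indicator_nonneg (fun x _ => hpnonneg x) x
  have hgm : Measurable g := hhmeas.mul hp'meas
  have hqm : Measurable q := hpmeas.indicator measurableSet_Icc
  have hgp' : ∀ x, g x ≤ p' x := fun x => mul_le_of_le_one_left (hp'nonneg x) (hh1 x)
  have hpA' : pA = fun x => q x / ∫ y in Icc (-τ) τ, p y := by
    funext x
    by_cases hx : x ∈ Icc (-τ) τ <;> simp [hpA, q, hx]
  have hr' : r = fun x => g x / ∫ y in Icc (-τ) τ, p y := by
    funext x
    rw [hr, hhmass]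
  have hfin : ∀ {f : ℝ → ℝ}, Measurable f → (∀ x, 0 ≤ f x) → Integrable f → ∀ t,
      rearrangedMass f t ≠ ⊤ := fun hf h0 hfi t =>
    ((rearrangedMass_le_lintegral hf h0 t).trans_lt hfi.lintegral_lt_top).ne
  intro t ht
  simp only [hr', hpA', symmRearrangement_div _ hA, integral_const_mul]
  refine mul_le_mul_of_nonneg_left ?_ (inv_nonneg.2 hA.le)
  rw [integral_symmRearrangement hgm hg0 hgi t, integral_symmRearrangement hqm hq0 hqi t]
  refine ENNReal.toReal_mono (hfin hqm hq0 hqi t) ?_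
  rcases le_total t τ with htτ | htτ
  · have hm := hmaj t ht
    rw [integral_symmRearrangement hp'meas hp'nonneg hp'i t,
      integral_symmRearrangement hpmeas hpnonneg hpi t,
      ENNReal.toReal_le_toReal (hfin hp'meas hp'nonneg hp'i t)
        (hfin hpmeas hpnonneg hpi t)] at hm
    exact (rearrangedMass_mono hgp' t).trans (hm.trans (rearrangedMass_le_indicator hanti htτ))
  · rw [rearrangedMass_indicator_of_le hpmeas hpnonneg htτ]
    refine (rearrangedMass_le_lintegral hgm hg0 t).trans (le_of_eq ?_)
    rw [← ofReal_integral_eq_lintegral_ofReal hgi (ae_of_all _ hg0),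
      ← ofReal_integral_eq_lintegral_ofReal hqi (ae_of_all _ hq0),
      integral_indicator measurableSet_Icc, hhmass]
end

section
/- The function γ ↦ 1 − (1/√(1+γ) + 1)·exp(−1/√(1+γ)) is strictly decreasing on [0,∞). Consequently, for any T > 0 and λ > 0, the minimal error J*(1,T) = T·(2/λ²)·[1 − (1/√(1+γ) + 1)·e^{−1/√(1+γ)}] is a strictly decreasing function of the signal-to-noise ratio γ. (Monotonicity of the minimal T-stage estimation error in the SNR, Section 5.) -/
open Set

lemma strictAntiOn_add_one_mul_exp_neg :
    StrictAntiOn (fun x : ℝ => (x + 1) * Real.exp (-x)) (Ici 0) := by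
  intro x hx y _ hxy
  have hx0 : 0 ≤ x := hx
  have h : y + 1 < (x + 1) * Real.exp (y - x) := by
    have hexp := Real.add_one_lt_exp (sub_ne_zero.2 hxy.ne')
    nlinarith [mul_nonneg hx0 (sub_nonneg.2 hxy.le)]
  calc (y + 1) * Real.exp (-y)
      < (x + 1) * Real.exp (y - x) * Real.exp (-y) :=
        mul_lt_mul_of_pos_right h (Real.exp_pos _)
    _ = (x + 1) * Real.exp (-x) := by
        rw [mul_assoc, ← Real.exp_add]
        ring_nf

lemma strictAntiOn_one_div_sqrt_one_add :
    StrictAntiOn (fun γ : ℝ => 1 / Real.sqrt (1 + γ)) (Ici 0) := by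
  intro a ha b _ hab
  have ha0 : 0 ≤ a := ha
  exact one_div_lt_one_div_of_lt (Real.sqrt_pos.2 (by linarith))
    (Real.sqrt_lt_sqrt (by linarith) (by linarith))

/-- Section 5: the function γ ↦ 1 − (1/√(1+γ) + 1)·exp(−1/√(1+γ)) is strictly
decreasing on [0,∞); consequently the minimal T-stage estimation error
J*(1,T) = T·(2/λ²)·[1 − (1/√(1+γ) + 1)e^{−1/√(1+γ)}] is strictly decreasing
in the SNR γ. -/
theorem stmt18 (T lam : ℝ) (hT : 0 < T) (hlam : 0 < lam) :
    StrictAntiOn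
      (fun γ : ℝ => 1 - (1 / Real.sqrt (1 + γ) + 1) *
        Real.exp (-1 / Real.sqrt (1 + γ))) (Ici 0) ∧
    StrictAntiOn
      (fun γ : ℝ => T * (2 / lam ^ 2) *
        (1 - (1 / Real.sqrt (1 + γ) + 1) *
          Real.exp (-1 / Real.sqrt (1 + γ)))) (Ici 0) := by
  have key : StrictAntiOn
      (fun γ : ℝ => 1 - (1 / Real.sqrt (1 + γ) + 1) *
        Real.exp (-1 / Real.sqrt (1 + γ))) (Ici 0) := by
    intro a ha b hb hab
    simp only [neg_div]
    exact sub_lt_sub_left (strictAntiOn_add_one_mul_exp_neg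
      (mem_Ici.2 (by positivity)) (mem_Ici.2 (by positivity))
      (strictAntiOn_one_div_sqrt_one_add ha hb hab)) 1
  exact ⟨key, fun a ha b hb hab =>
    mul_lt_mul_of_pos_left (key ha hb hab) (by positivity)⟩
end
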